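/- arXiv:2405.12535 — 10 statements merged into one kernel-verified Lean document; each statement's English description precedes it below -/
import Mathlib

section
/- For every integer i ≥ 1, let β > 0, Δt > 0, let r : ℝ^d → ℝ be bounded and continuously differentiable with ‖∇r‖_∞ < ∞, and let μ : ℝ^d → ℝ^d be Lipschitz with constant L satisfying L < β. Suppose that for every x ∈ ℝ^d a trajectory s^x of μ starting at x exists, that t ↦ s^x(t) is (i+1)-times continuously differentiable, and that ‖(d^{i+1}/dt^{i+1}) s^x(t)‖ ≤ M uniformly in t ≥ 0 and x ∈ ℝ^d. Define μ̂_i(x) = (1/Δt) ∑_{j=1}^i a^{(i)}_j (s^x(jΔt) − x) and suppose that for every x a trajectory ŝ^x of μ̂_i starting at x exists. Let V(x) = ∫₀^∞ e^{−βt} r(s^x(t)) dt and V̂_i(x) = ∫₀^∞ e^{−βt} r(ŝ^x(t)) dt. Then sup_{x ∈ ℝ^d} |V̂_i(x) − V(x)| ≤ 2 C_i ‖∇r‖_∞ M (Δt)^i / (β − L)². -/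
open MeasureTheory Real

section Taylor

variable {E : Type*} [NormedAddCommGroup E] [NormedSpace ℝ E]

/-- Taylor's inequality at `0` for vector-valued functions, with the sharp constant `1 / n!`. -/
theorem norm_sub_taylor_sum_le {n : ℕ} {f : ℝ → E} {M : ℝ} (hf : ContDiff ℝ n f)
    (hM : ∀ t ≥ (0 : ℝ), ‖iteratedDeriv n f t‖ ≤ M) {t : ℝ} (ht : 0 ≤ t) :
    ‖f t - ∑ k ∈ Finset.range n, (t ^ k / (k.factorial : ℝ)) • iteratedDeriv k f 0‖ ≤
      M * t ^ n / (n.factorial : ℝ) := by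
  induction n generalizing f t with
  | zero => simpa using hM t ht
  | succ n ih =>
    have hf' : Differentiable ℝ f ∧ ContDiff ℝ n (deriv f) := by
      have := contDiff_succ_iff_deriv.1 (by exact_mod_cast hf : ContDiff ℝ ((n : WithTop ℕ∞) + 1) f)
      exact ⟨this.1, this.2.2⟩
    have hpow (k : ℕ) (y : ℝ) : HasDerivAt (fun t : ℝ => t ^ (k + 1) / ((k + 1).factorial : ℝ))
        (y ^ k / (k.factorial : ℝ)) y := by
      convert! (hasDerivAt_pow (k + 1) y).div_const ((k + 1).factorial : ℝ) using 1
      rw [Nat.factorial_succ]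
      push_cast
      have : (k.factorial : ℝ) ≠ 0 := by positivity
      have : (k : ℝ) + 1 ≠ 0 := by positivity
      field_simp
    have hder (y : ℝ) : HasDerivAt
        (fun t => f t - ∑ k ∈ Finset.range (n + 1),
          (t ^ k / (k.factorial : ℝ)) • iteratedDeriv k f 0)
        (deriv f y - ∑ k ∈ Finset.range n,
          (y ^ k / (k.factorial : ℝ)) • iteratedDeriv k (deriv f) 0) y := by
      simp only [Finset.sum_range_succ', pow_zero, iteratedDeriv_succ']
      refine (hf'.1 y).hasDerivAt.sub ((HasDerivAt.fun_sum fun k _ => ?_).add_const _)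
      exact (hpow k y).smul_const _
    refine image_norm_le_of_norm_deriv_right_le_deriv_boundary (a := 0) (b := t)
      (B := fun t => M * t ^ (n + 1) / ((n + 1).factorial : ℝ))
      (B' := fun t => M * t ^ n / (n.factorial : ℝ))
      (fun y _ => (hder y).continuousAt.continuousWithinAt)
      (fun y _ => (hder y).hasDerivWithinAt) ?_ (fun y => ?_) (fun y hy => ?_)
      (Set.right_mem_Icc.2 ht)
    · simp [Finset.sum_range_succ']
    · simpa only [mul_div_assoc] using (hpow n y).const_mul M
    · exact ih hf'.2 (fun u hu => by simpa only [iteratedDeriv_succ'] using hM u hu) hy.1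

/-- A finite difference formula that is exact on polynomials of degree at most `i` approximates the
derivative with an error of order `h ^ i`. -/
theorem norm_finite_difference_sub_deriv_le {i : ℕ} (hi : 1 ≤ i) {h M : ℝ} (hh : 0 < h)
    {a : ℕ → ℝ}
    (ha0 : ∀ k ≤ i, k ≠ 1 → ∑ j ∈ Finset.range (i + 1), a j * (j : ℝ) ^ k = 0)
    (ha1 : ∑ j ∈ Finset.range (i + 1), a j * (j : ℝ) = 1)
    {f : ℝ → E} (hf : ContDiff ℝ (i + 1 : ℕ) f)
    (hM : ∀ t ≥ (0 : ℝ), ‖iteratedDeriv (i + 1) f t‖ ≤ M) :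
    ‖h⁻¹ • ∑ j ∈ Finset.Icc 1 i, a j • (f ((j : ℝ) * h) - f 0) - deriv f 0‖ ≤
      (∑ j ∈ Finset.range (i + 1), |a j| * (j : ℝ) ^ (i + 1)) / ((i + 1).factorial : ℝ) *
        M * h ^ i := by
  have hsum : ∑ j ∈ Finset.Icc 1 i, a j • (f ((j : ℝ) * h) - f 0) =
      ∑ j ∈ Finset.range (i + 1), a j • f ((j : ℝ) * h) := by
    have h0 : ∑ j ∈ Finset.range (i + 1), a j = 0 := by simpa using ha0 0 (by lia) (by lia)
    have : ∑ j ∈ Finset.range (i + 1), a j • f ((j : ℝ) * h) =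
        ∑ j ∈ Finset.range (i + 1), a j • (f ((j : ℝ) * h) - f 0) := by
      simp [smul_sub, Finset.sum_sub_distrib, ← Finset.sum_smul, h0]
    rw [this]
    refine Finset.sum_subset (fun j hj => ?_) (fun j hj hj' => ?_)
    · simp only [Finset.mem_Icc, Finset.mem_range] at *
      lia
    · obtain rfl : j = 0 := by
        simp only [Finset.mem_Icc, Finset.mem_range] at *
        lia
      simp
  have hpoly : ∑ j ∈ Finset.range (i + 1), a j • ∑ k ∈ Finset.range (i + 1),
      (((j : ℝ) * h) ^ k / (k.factorial : ℝ)) • iteratedDeriv k f 0 = h • deriv f 0 := by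
    have (k : ℕ) : ∑ j ∈ Finset.range (i + 1),
        a j • (((j : ℝ) * h) ^ k / (k.factorial : ℝ)) • iteratedDeriv k f 0 =
        ((∑ j ∈ Finset.range (i + 1), a j * (j : ℝ) ^ k) * (h ^ k / (k.factorial : ℝ))) •
          iteratedDeriv k f 0 := by
      rw [Finset.sum_mul, Finset.sum_smul]
      refine Finset.sum_congr rfl fun j _ => ?_
      rw [smul_smul]
      congr 1
      ring
    simp_rw [Finset.smul_sum]
    rw [Finset.sum_comm]
    simp_rw [this]
    rw [Finset.sum_eq_single 1]
    · simp [ha1]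
    · intro k hk hk1
      rw [ha0 k (by simpa [Nat.lt_succ_iff] using hk) hk1]
      simp
    · intro hk
      simp only [Finset.mem_range] at hk
      lia
  have hrem : h⁻¹ • ∑ j ∈ Finset.Icc 1 i, a j • (f ((j : ℝ) * h) - f 0) - deriv f 0 =
      h⁻¹ • ∑ j ∈ Finset.range (i + 1), a j • (f ((j : ℝ) * h) - ∑ k ∈ Finset.range (i + 1),
        (((j : ℝ) * h) ^ k / (k.factorial : ℝ)) • iteratedDeriv k f 0) := by
    rw [hsum]
    simp_rw [smul_sub (a _)]
    rw [Finset.sum_sub_distrib, hpoly, smul_sub, inv_smul_smul₀ hh.ne']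
  rw [hrem, norm_smul, norm_inv, Real.norm_of_nonneg hh.le, inv_mul_le_iff₀ hh]
  calc _ ≤ ∑ j ∈ Finset.range (i + 1),
        |a j| * (M * ((j : ℝ) * h) ^ (i + 1) / ((i + 1).factorial : ℝ)) := by
        refine norm_sum_le_of_le _ fun j _ => ?_
        rw [norm_smul, Real.norm_eq_abs]
        gcongr
        exact norm_sub_taylor_sum_le hf hM (by positivity)
    _ = _ := by
        simp_rw [Finset.sum_div, Finset.sum_mul, Finset.mul_sum]
        refine Finset.sum_congr rfl fun j _ => ?_
        ring

end Taylor

theorem gronwallBound_zero_le {K ε t : ℝ} (hK : 0 ≤ K) (hε : 0 ≤ ε) :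
    gronwallBound 0 K ε t ≤ ε * (t * exp (K * t)) := by
  rcases hK.eq_or_lt with rfl | hK
  · simp [gronwallBound_K0]
  · rw [gronwallBound_of_K_ne_0 hK.ne']
    have h : exp (K * t) - 1 ≤ K * t * exp (K * t) := by
      have h1 := mul_le_mul_of_nonneg_right (one_sub_le_exp_neg (K * t)) (exp_pos (K * t)).le
      rw [← exp_add, neg_add_cancel, exp_zero] at h1
      linarith
    calc _ = ε / K * (exp (K * t) - 1) := by ring
      _ ≤ ε / K * (K * t * exp (K * t)) := by gcongr
      _ = _ := by field_simp

theorem integrableOn_exp_neg_mul_mul {β B : ℝ} (hβ : 0 < β) {u : ℝ → ℝ}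
    (hu : ContinuousOn u (Set.Ici 0)) (hB : ∀ t, |u t| ≤ B) :
    IntegrableOn (fun t => exp (-β * t) * u t) (Set.Ioi 0) := by
  refine (exp_neg_integrableOn_Ioi 0 hβ).mul_bdd (c := B) ?_ (.of_forall hB)
  exact (hu.mono Set.Ioi_subset_Ici_self).aestronglyMeasurable measurableSet_Ioi

/-- Two discounted integrals whose integrands differ by at most `A * t * exp (K * t)`. -/
theorem abs_integral_exp_neg_mul_sub_le {β K A B : ℝ} (hβ : 0 < β) (hK : K < β) {u v : ℝ → ℝ}
    (hu : ContinuousOn u (Set.Ici 0)) (hv : ContinuousOn v (Set.Ici 0))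
    (huB : ∀ t, |u t| ≤ B) (hvB : ∀ t, |v t| ≤ B)
    (huv : ∀ t > (0 : ℝ), |u t - v t| ≤ A * (t * exp (K * t))) :
    |(∫ t in Set.Ioi (0 : ℝ), exp (-β * t) * u t) - ∫ t in Set.Ioi (0 : ℝ), exp (-β * t) * v t| ≤
      A / (β - K) ^ 2 := by
  have hβK : 0 < β - K := sub_pos.2 hK
  have hint : IntegrableOn (fun t : ℝ => A * (t * exp (-(β - K) * t))) (Set.Ioi 0) := by
    have := integrableOn_rpow_mul_exp_neg_mul_rpow (s := 1) (p := 1) (by norm_num) one_pos hβK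
    simp only [rpow_one] at this
    exact this.const_mul A
  have hval : ∫ t in Set.Ioi (0 : ℝ), A * (t * exp (-(β - K) * t)) = A / (β - K) ^ 2 := by
    have := integral_rpow_mul_exp_neg_mul_Ioi (a := 2) two_pos hβK
    norm_num [← neg_mul] at this
    rw [integral_const_mul]
    simp only [neg_sub]
    rw [this, div_eq_mul_inv]
  rw [← integral_sub (integrableOn_exp_neg_mul_mul hβ hu huB)
    (integrableOn_exp_neg_mul_mul hβ hv hvB), ← Real.norm_eq_abs, ← hval]
  refine norm_integral_le_of_norm_le hint ?_
  filter_upwards [ae_restrict_mem measurableSet_Ioi] with t ht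
  rw [← mul_sub, norm_mul, Real.norm_of_nonneg (exp_pos _).le, Real.norm_eq_abs]
  calc _ ≤ exp (-β * t) * (A * (t * exp (K * t))) := by
        gcongr
        exact huv t ht
    _ = A * (t * (exp (-β * t) * exp (K * t))) := by ring
    _ = _ := by
        rw [← exp_add]
        ring_nf

/-- Stability of a discounted value function under a perturbation of the vector field. -/
theorem abs_discounted_value_sub_le {E : Type*} [NormedAddCommGroup E] [NormedSpace ℝ E]
    {β Dr ε : ℝ} {K : NNReal} (hβ : 0 < β) (hK : K < β) (hε : 0 ≤ ε) {r : E → ℝ}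
    (hr : Differentiable ℝ r) (hrbdd : ∃ B, ∀ x, |r x| ≤ B) (hDr : ∀ x, ‖fderiv ℝ r x‖ ≤ Dr)
    {μ : E → E} (hμ : LipschitzWith K μ) {f g f' : ℝ → E} (h0 : f 0 = g 0)
    (hf : ∀ t ≥ (0 : ℝ), HasDerivAt f (f' t) t)
    (hff' : ∀ t ≥ (0 : ℝ), ‖f' t - μ (f t)‖ ≤ ε)
    (hg : ∀ t ≥ (0 : ℝ), HasDerivAt g (μ (g t)) t) :
    |(∫ t in Set.Ioi (0 : ℝ), exp (-β * t) * r (f t)) -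
        ∫ t in Set.Ioi (0 : ℝ), exp (-β * t) * r (g t)| ≤ Dr * ε / (β - K) ^ 2 := by
  obtain ⟨B, hB⟩ := hrbdd
  have hfc : ContinuousOn f (Set.Ici 0) := fun t ht => (hf t ht).continuousAt.continuousWithinAt
  have hgc : ContinuousOn g (Set.Ici 0) := fun t ht => (hg t ht).continuousAt.continuousWithinAt
  refine abs_integral_exp_neg_mul_sub_le hβ hK (hr.continuous.comp_continuousOn hfc)
    (hr.continuous.comp_continuousOn hgc) (fun t => hB _) (fun t => hB _) fun t ht => ?_
  have hdist : dist (f t) (g t) ≤ gronwallBound 0 K (ε + 0) (t - 0) :=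
    dist_le_of_approx_trajectories_ODE (v := fun _ => μ) (fun _ => hμ)
      (hfc.mono Set.Icc_subset_Ici_self) (fun u hu => (hf u hu.1).hasDerivWithinAt)
      (fun u hu => by simpa [dist_eq_norm] using hff' u hu.1)
      (hgc.mono Set.Icc_subset_Ici_self) (fun u hu => (hg u hu.1).hasDerivWithinAt)
      (fun u _ => (dist_self _).le) (by simp [h0]) t ⟨ht.le, le_rfl⟩
  rw [add_zero, sub_zero, dist_eq_norm] at hdist
  have hDr0 : 0 ≤ Dr := (norm_nonneg _).trans (hDr 0)
  calc |r (f t) - r (g t)| ≤ Dr * ‖f t - g t‖ :=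
        convex_univ.norm_image_sub_le_of_norm_fderiv_le (𝕜 := ℝ) (fun x _ => hr x)
          (fun x _ => hDr x) (Set.mem_univ _) (Set.mem_univ _)
    _ ≤ Dr * (ε * (t * exp (K * t))) := by
        gcongr
        exact hdist.trans (gronwallBound_zero_le K.coe_nonneg hε)
    _ = _ := by ring

open MeasureTheory Real

/-- Discretization error for the i-th order PhiBE under deterministic dynamics
(Theorem `thm:v-vhat_deter`). -/
theorem phibe_deterministic_discretization_error {d : ℕ} (i : ℕ) (hi : 1 ≤ i)
    (β Δt M Dr L : ℝ) (hβ : 0 < β) (hΔt : 0 < Δt)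
    (a : ℕ → ℝ)
    (ha0 : ∀ k ≤ i, k ≠ 1 → ∑ j ∈ Finset.range (i + 1), a j * (j : ℝ) ^ k = 0)
    (ha1 : ∑ j ∈ Finset.range (i + 1), a j * (j : ℝ) = 1)
    (r : EuclideanSpace ℝ (Fin d) → ℝ)
    (hr : ContDiff ℝ 1 r) (hrbdd : ∃ B, ∀ x, |r x| ≤ B)
    (hDr : ∀ x, ‖fderiv ℝ r x‖ ≤ Dr)
    (μ : EuclideanSpace ℝ (Fin d) → EuclideanSpace ℝ (Fin d))
    (hL : LipschitzWith (Real.toNNReal L) μ) (hLβ : L < β)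
    (s : EuclideanSpace ℝ (Fin d) → ℝ → EuclideanSpace ℝ (Fin d))
    (hs0 : ∀ x, s x 0 = x)
    (hs : ∀ x, ∀ t ≥ (0 : ℝ), HasDerivAt (s x) (μ (s x t)) t)
    (hsmooth : ∀ x, ContDiff ℝ (i + 1 : ℕ) (s x))
    (hM : ∀ x, ∀ t ≥ (0 : ℝ), ‖iteratedDeriv (i + 1) (s x) t‖ ≤ M)
    (shat : EuclideanSpace ℝ (Fin d) → ℝ → EuclideanSpace ℝ (Fin d))
    (hshat0 : ∀ x, shat x 0 = x)
    (hshat : ∀ x, ∀ t ≥ (0 : ℝ), HasDerivAt (shat x)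
      (Δt⁻¹ • ∑ j ∈ Finset.Icc 1 i, a j • (s (shat x t) ((j : ℝ) * Δt) - shat x t)) t) :
    ∀ x : EuclideanSpace ℝ (Fin d),
      |(∫ t in Set.Ioi (0 : ℝ), Real.exp (-β * t) * r (shat x t)) -
        ∫ t in Set.Ioi (0 : ℝ), Real.exp (-β * t) * r (s x t)| ≤
      2 * ((∑ j ∈ Finset.range (i + 1), |a j| * (j : ℝ) ^ (i + 1)) /
          (Nat.factorial (i + 1) : ℝ)) * Dr * M * Δt ^ i / (β - L) ^ 2 := by
  intro x
  have hDr0 : 0 ≤ Dr := (norm_nonneg _).trans (hDr 0)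
  have hM0 : 0 ≤ M := (norm_nonneg _).trans (hM 0 0 le_rfl)
  set C := (∑ j ∈ Finset.range (i + 1), |a j| * (j : ℝ) ^ (i + 1)) /
    (Nat.factorial (i + 1) : ℝ) with hC
  have hC0 : 0 ≤ C := by positivity
  have hβL : 0 < β - L := sub_pos.2 hLβ
  have hμhat (y : EuclideanSpace ℝ (Fin d)) :
      ‖Δt⁻¹ • ∑ j ∈ Finset.Icc 1 i, a j • (s y ((j : ℝ) * Δt) - y) - μ y‖ ≤ C * M * Δt ^ i := by
    have := norm_finite_difference_sub_deriv_le hi hΔt ha0 ha1 (hsmooth y) (hM y)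
    rwa [(hs y 0 le_rfl).deriv, hs0] at this
  have h0 : shat x 0 = s x 0 := by rw [hshat0, hs0]
  rcases le_or_gt 0 L with hL0 | hL0
  · have hLc : (L.toNNReal : ℝ) = L := Real.coe_toNNReal L hL0
    refine (abs_discounted_value_sub_le (ε := C * M * Δt ^ i) hβ (by rwa [hLc]) (by positivity)
      (hr.differentiable one_ne_zero) hrbdd hDr hL h0 (hshat x) (fun t _ => hμhat _)
      (hs x)).trans ?_
    rw [hLc]
    gcongr ?_ / _
    have : 0 ≤ C * Dr * M * Δt ^ i := by positivity
    linarith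
  · rw [Real.toNNReal_of_nonpos hL0.le] at hL
    have hconst (y z : EuclideanSpace ℝ (Fin d)) : μ y = μ z := by
      simpa using hL.dist_le_mul y z
    have hline (y : EuclideanSpace ℝ (Fin d)) (t : ℝ) (ht : 0 ≤ t) : s y t - y = t • μ y := by
      have hder (u : ℝ) (hu : 0 ≤ u) : HasDerivAt (fun u => s y u - u • μ y) 0 u := by
        simpa [hconst (s y u) y] using (hs y u hu).fun_sub ((hasDerivAt_id u).smul_const (μ y))
      have := (convex_Ici (0 : ℝ)).norm_image_sub_le_of_norm_hasDerivWithin_le (C := 0)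
        (fun u hu => (hder u hu).hasDerivWithinAt) (fun _ _ => by simp)
        Set.self_mem_Ici (Set.mem_Ici.2 ht)
      rw [zero_mul, norm_le_zero_iff, hs0] at this
      simp only [zero_smul, sub_zero] at this
      rw [← sub_eq_zero, ← this]
      abel
    have hexact (y : EuclideanSpace ℝ (Fin d)) :
        Δt⁻¹ • ∑ j ∈ Finset.Icc 1 i, a j • (s y ((j : ℝ) * Δt) - y) = μ y := by
      have hterm (j : ℕ) : a j • (s y ((j : ℝ) * Δt) - y) = (a j * j) • Δt • μ y := by
        rw [hline y _ (by positivity), smul_smul, smul_smul, mul_assoc]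
      have hsum : ∑ j ∈ Finset.Icc 1 i, a j * (j : ℝ) = 1 := by
        rw [← ha1, Finset.range_eq_Ico, Finset.sum_eq_sum_Ico_succ_bot (by lia)]
        simp [Finset.Ico_add_one_right_eq_Icc]
      rw [Finset.sum_congr rfl fun j _ => hterm j, ← Finset.sum_smul, hsum, one_smul,
        inv_smul_smul₀ hΔt.ne']
    refine (abs_discounted_value_sub_le (ε := 0) hβ (by simpa using hβ) le_rfl
      (hr.differentiable one_ne_zero) hrbdd hDr hL h0 (hshat x)
      (fun t _ => by rw [hexact, sub_self, norm_zero]) (hs x)).trans ?_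
    rw [mul_zero, zero_div]
    positivity
end

section
/- Let β > 0, λ ∈ ℝ, i ≥ 1 an integer, and Δt > 0. Let r : ℝ → ℝ be bounded and continuously differentiable with K := sup_{u ∈ ℝ} |u · r'(u)| < ∞. Define λ̂ = (1/Δt) ∑_{j=1}^i a^{(i)}_j (e^{λjΔt} − 1), and set V(x) = ∫₀^∞ e^{−βt} r(e^{λt} x) dt and V̂_i(x) = ∫₀^∞ e^{−βt} r(e^{λ̂ t} x) dt. Then for every x ∈ ℝ, |V̂_i(x) − V(x)| ≤ (C_i / β²) · K · |λ| · (e^{|λ|Δt}|λ|)^i · (Δt)^i. -/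
open MeasureTheory Real

/-- Taylor's theorem for `exp` at `0`, with the Lagrange bound on the remainder. -/
lemma abs_exp_sub_sum_range_le (y : ℝ) (n : ℕ) :
    |Real.exp y - ∑ k ∈ Finset.range (n + 1), y ^ k / (Nat.factorial k : ℝ)| ≤
      |y| ^ (n + 1) / (Nat.factorial (n + 1) : ℝ) * Real.exp |y| := by
  rcases eq_or_ne 0 y with rfl | hy
  · simp [Finset.sum_range_succ']
  obtain ⟨z, hz, hzeq⟩ := taylor_mean_remainder_lagrange_iteratedDeriv (f := Real.exp) (n := n) hy
    Real.contDiff_exp.contDiffOn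
  have hT : taylorWithinEval Real.exp n (Set.uIcc 0 y) 0 y =
      ∑ k ∈ Finset.range (n + 1), y ^ k / (Nat.factorial k : ℝ) := by
    rw [taylor_within_apply]
    refine Finset.sum_congr rfl fun k _ => ?_
    rw [iteratedDerivWithin_eq_iteratedDeriv (uniqueDiffOn_uIcc hy)
      Real.contDiff_exp.contDiffAt Set.left_mem_uIcc, iteratedDeriv_eq_iterate]
    simp [div_eq_inv_mul]
  rw [hT, iteratedDeriv_eq_iterate, Real.iter_deriv_exp, sub_zero] at hzeq
  rw [hzeq, abs_div, abs_mul, abs_pow, Real.abs_exp, Nat.abs_cast, mul_div_assoc, mul_comm]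
  gcongr
  have hz' := Set.uIoo_subset_uIcc_self hz
  rcases Set.mem_uIcc.1 hz' with h | h
  · exact h.2.trans (le_abs_self y)
  · exact h.2.trans (abs_nonneg y)

/-- Consistency error of a finite-difference formula of order `i` for the derivative at `0`,
applied to `t ↦ exp (lam * t)`. -/
lemma abs_finite_difference_exp_sub_le {lam Δt : ℝ} (hΔt : 0 < Δt) {i : ℕ} (hi : 1 ≤ i)
    {a : ℕ → ℝ}
    (ha0 : ∀ k ≤ i, k ≠ 1 → ∑ j ∈ Finset.range (i + 1), a j * (j : ℝ) ^ k = 0)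
    (ha1 : ∑ j ∈ Finset.range (i + 1), a j * (j : ℝ) = 1) :
    |Δt⁻¹ * ∑ j ∈ Finset.Icc 1 i, a j * (Real.exp (lam * j * Δt) - 1) - lam| ≤
      ((∑ j ∈ Finset.range (i + 1), |a j| * (j : ℝ) ^ (i + 1)) / (Nat.factorial (i + 1) : ℝ)) *
        |lam| * (Real.exp (|lam| * Δt) * |lam|) ^ i * Δt ^ i := by
  have hsum : ∑ j ∈ Finset.Icc 1 i, a j * (Real.exp (lam * j * Δt) - 1) =
      ∑ j ∈ Finset.range (i + 1), a j * Real.exp (lam * j * Δt) := by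
    have h0 := ha0 0 (Nat.zero_le i) zero_ne_one
    simp only [pow_zero, mul_one] at h0
    calc _ = ∑ j ∈ Finset.range (i + 1), a j * (Real.exp (lam * j * Δt) - 1) := by
          refine Finset.sum_subset (fun j hj => ?_) fun j hj hj' => ?_
          · simp only [Finset.mem_Icc, Finset.mem_range] at *; lia
          · obtain rfl : j = 0 := by simp only [Finset.mem_Icc, Finset.mem_range] at *; lia
            simp
      _ = _ := by simp only [mul_sub, Finset.sum_sub_distrib, mul_one, h0, sub_zero]
  have hpoly : ∑ j ∈ Finset.range (i + 1), a j *
      ∑ k ∈ Finset.range (i + 1), (lam * j * Δt) ^ k / (Nat.factorial k : ℝ) = lam * Δt := by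
    simp only [Finset.mul_sum]
    rw [Finset.sum_comm]
    have hterm : ∀ k, ∑ j ∈ Finset.range (i + 1),
        a j * ((lam * j * Δt) ^ k / (Nat.factorial k : ℝ)) =
        (lam * Δt) ^ k / (Nat.factorial k : ℝ) *
          ∑ j ∈ Finset.range (i + 1), a j * (j : ℝ) ^ k := fun k => by
      rw [Finset.mul_sum]
      exact Finset.sum_congr rfl fun j _ => by ring
    simp only [hterm]
    rw [Finset.sum_eq_single_of_mem 1 (Finset.mem_range.2 (by lia))]
    · simp [ha1]
    · intro k hk hk1
      rw [ha0 k (Nat.lt_succ_iff.1 (Finset.mem_range.1 hk)) hk1, mul_zero]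
  have herr : Δt⁻¹ * ∑ j ∈ Finset.Icc 1 i, a j * (Real.exp (lam * j * Δt) - 1) - lam =
      Δt⁻¹ * ∑ j ∈ Finset.range (i + 1), a j * (Real.exp (lam * j * Δt) -
        ∑ k ∈ Finset.range (i + 1), (lam * j * Δt) ^ k / (Nat.factorial k : ℝ)) := by
    simp_rw [hsum, mul_sub (a _), Finset.sum_sub_distrib, hpoly]
    field_simp
  rw [herr, abs_mul, abs_of_pos (inv_pos.2 hΔt)]
  calc _ ≤ Δt⁻¹ * ∑ j ∈ Finset.range (i + 1), |a j| * ((|lam| * j * Δt) ^ (i + 1) /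
        (Nat.factorial (i + 1) : ℝ) * Real.exp (|lam| * Δt) ^ i) := by
        gcongr
        refine (Finset.abs_sum_le_sum_abs _ _).trans (Finset.sum_le_sum fun j hj => ?_)
        have hji : (j : ℝ) ≤ i := by
          exact_mod_cast Nat.lt_succ_iff.1 (Finset.mem_range.1 hj)
        have habs : |lam * j * Δt| = |lam| * j * Δt := by
          rw [abs_mul, abs_mul, Nat.abs_cast, abs_of_pos hΔt]
        rw [abs_mul]
        refine mul_le_mul_of_nonneg_left ((abs_exp_sub_sum_range_le _ i).trans ?_) (abs_nonneg _)
        rw [habs, ← Real.exp_nat_mul]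
        rw [show |lam| * j * Δt = j * (|lam| * Δt) by ring]
        gcongr
    _ = _ := by
        rw [Finset.mul_sum, Finset.sum_div, Finset.sum_mul, Finset.sum_mul, Finset.sum_mul]
        refine Finset.sum_congr rfl fun j _ => ?_
        rw [mul_pow (Real.exp _)]
        field_simp
        ring

/-- If `|u * r' u| ≤ K`, then `s ↦ r (exp (s * t) * x)` is Lipschitz with constant `K * |t|`. -/
lemma abs_comp_exp_mul_sub_le {r : ℝ → ℝ} (hr : Differentiable ℝ r) {K : ℝ}
    (hK : ∀ u : ℝ, |u * deriv r u| ≤ K) (x t s₁ s₂ : ℝ) :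
    |r (Real.exp (s₁ * t) * x) - r (Real.exp (s₂ * t) * x)| ≤ K * |t| * |s₁ - s₂| := by
  have hderiv : ∀ s : ℝ, HasDerivAt (fun s => r (Real.exp (s * t) * x))
      (deriv r (Real.exp (s * t) * x) * (Real.exp (s * t) * (1 * t) * x)) s := fun s =>
    (hr _).hasDerivAt.comp s ((((hasDerivAt_id s).mul_const t).exp).mul_const x)
  refine Convex.norm_image_sub_le_of_norm_hasDerivWithin_le (s := Set.univ)
    (fun s _ => (hderiv s).hasDerivWithinAt) (fun s _ => ?_) convex_univ
    (Set.mem_univ s₂) (Set.mem_univ s₁)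
  calc _ = |Real.exp (s * t) * x * deriv r (Real.exp (s * t) * x)| * |t| := by
        rw [Real.norm_eq_abs, ← abs_mul]; ring_nf
    _ ≤ K * |t| := by gcongr; exact hK _

lemma integrableOn_exp_neg_mul_bounded {β : ℝ} (hβ : 0 < β) {g : ℝ → ℝ} (hg : Continuous g)
    {B : ℝ} (hB : ∀ t, |g t| ≤ B) :
    IntegrableOn (fun t => Real.exp (-β * t) * g t) (Set.Ioi 0) :=
  (exp_neg_integrableOn_Ioi 0 hβ).mul_bdd hg.aestronglyMeasurable
    (Filter.Eventually.of_forall hB)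

lemma integrableOn_exp_neg_mul_self {β : ℝ} (hβ : 0 < β) :
    IntegrableOn (fun t => Real.exp (-β * t) * t) (Set.Ioi 0) := by
  have h := integrableOn_rpow_mul_exp_neg_mul_rpow (p := 1) (s := 1) (by norm_num) one_pos hβ
  simpa [mul_comm] using h

lemma integral_exp_neg_mul_self {β : ℝ} (hβ : 0 < β) :
    ∫ t in Set.Ioi (0 : ℝ), Real.exp (-β * t) * t = 1 / β ^ 2 := by
  have h := Real.integral_rpow_mul_exp_neg_mul_Ioi (a := 2) two_pos hβ
  have h21 : (2 : ℝ) - 1 = 1 := by norm_num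
  simpa [h21, mul_comm, Real.Gamma_two] using h

/-- The discounted value depends on the rate of a linear flow in a Lipschitz way. -/
lemma abs_discounted_integral_sub_le {β : ℝ} (hβ : 0 < β) {r : ℝ → ℝ} (hr : Differentiable ℝ r)
    {B : ℝ} (hB : ∀ u, |r u| ≤ B) {K : ℝ} (hK : ∀ u : ℝ, |u * deriv r u| ≤ K) (x s₁ s₂ : ℝ) :
    |(∫ t in Set.Ioi (0 : ℝ), Real.exp (-β * t) * r (Real.exp (s₁ * t) * x)) -
      ∫ t in Set.Ioi (0 : ℝ), Real.exp (-β * t) * r (Real.exp (s₂ * t) * x)| ≤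
    K / β ^ 2 * |s₁ - s₂| := by
  have hint : ∀ s : ℝ, IntegrableOn
      (fun t => Real.exp (-β * t) * r (Real.exp (s * t) * x)) (Set.Ioi 0) := fun s =>
    integrableOn_exp_neg_mul_bounded hβ (hr.continuous.comp (by fun_prop)) fun t => hB _
  rw [← integral_sub (hint s₁) (hint s₂), ← Real.norm_eq_abs]
  calc _ ≤ ∫ t in Set.Ioi (0 : ℝ), K * |s₁ - s₂| * (Real.exp (-β * t) * t) := by
        refine norm_integral_le_of_norm_le ((integrableOn_exp_neg_mul_self hβ).const_mul _) ?_
        filter_upwards [ae_restrict_mem measurableSet_Ioi] with t ht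
        have h := abs_comp_exp_mul_sub_le hr hK x t s₁ s₂
        rw [abs_of_pos (Set.mem_Ioi.1 ht)] at h
        rw [← mul_sub, Real.norm_eq_abs, abs_mul, Real.abs_exp]
        calc _ ≤ Real.exp (-β * t) * (K * t * |s₁ - s₂|) := by gcongr
          _ = _ := by ring
    _ = _ := by
        rw [integral_const_mul, integral_exp_neg_mul_self hβ]
        ring

/-- Discretization error for the i-th order PhiBE under scalar linear dynamics
(Theorem `thm: linear deter`, scalar case). -/
theorem phibe_linear_dynamics_error (β lam Δt : ℝ) (hβ : 0 < β) (hΔt : 0 < Δt)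
    (i : ℕ) (hi : 1 ≤ i)
    (a : ℕ → ℝ)
    (ha0 : ∀ k ≤ i, k ≠ 1 → ∑ j ∈ Finset.range (i + 1), a j * (j : ℝ) ^ k = 0)
    (ha1 : ∑ j ∈ Finset.range (i + 1), a j * (j : ℝ) = 1)
    (r : ℝ → ℝ) (hr : ContDiff ℝ 1 r) (hrbdd : ∃ B, ∀ u, |r u| ≤ B)
    (K : ℝ) (hK : ∀ u : ℝ, |u * deriv r u| ≤ K)
    (lamhat : ℝ)
    (hlamhat : lamhat = Δt⁻¹ * ∑ j ∈ Finset.Icc 1 i, a j * (Real.exp (lam * j * Δt) - 1))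
    (x : ℝ) :
    |(∫ t in Set.Ioi (0 : ℝ), Real.exp (-β * t) * r (Real.exp (lamhat * t) * x)) -
      ∫ t in Set.Ioi (0 : ℝ), Real.exp (-β * t) * r (Real.exp (lam * t) * x)| ≤
    ((∑ j ∈ Finset.range (i + 1), |a j| * (j : ℝ) ^ (i + 1)) / (Nat.factorial (i + 1) : ℝ)) /
        β ^ 2 * K * |lam| * (Real.exp (|lam| * Δt) * |lam|) ^ i * Δt ^ i := by
  obtain ⟨B, hB⟩ := hrbdd
  have hK0 : 0 ≤ K := (abs_nonneg _).trans (hK 0)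
  refine (abs_discounted_integral_sub_le hβ (hr.differentiable one_ne_zero) hB hK x
    lamhat lam).trans ?_
  rw [hlamhat]
  refine (mul_le_mul_of_nonneg_left (abs_finite_difference_exp_sub_le hΔt hi ha0 ha1)
    (by positivity)).trans_eq ?_
  ring
end

section
/- Let β > 0, Δt > 0, let μ : ℝ^d → ℝ^d, and let r : ℝ^d → ℝ be continuously differentiable with ‖r‖_∞ ≤ R₀ and sup_{x} |⟨μ(x), ∇r(x)⟩| ≤ R_L. Let s be a trajectory of μ starting at x ∈ ℝ^d, and set V(x) = ∫₀^∞ e^{−βt} r(s(t)) dt and Ṽ(x) = Δt ∑_{j=0}^∞ e^{−βjΔt} r(s(jΔt)). Then |V(x) − Ṽ(x)| ≤ ½ (β R₀ + R_L) · Δt² / (1 − e^{−βΔt}). -/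
open MeasureTheory Real

/-- The left-endpoint rule on `[a, b]` has error at most `K (b - a)² / 2` when `|f'| ≤ K`. -/
lemma abs_intervalIntegral_sub_left_endpoint_le {f f' : ℝ → ℝ} {a b K : ℝ} (hab : a ≤ b)
    (hf : ∀ t ∈ Set.Icc a b, HasDerivAt f (f' t) t) (hK : ∀ t ∈ Set.Icc a b, |f' t| ≤ K) :
    |(∫ t in a..b, f t) - (b - a) * f a| ≤ K * (b - a) ^ 2 / 2 := by
  have hcont : ContinuousOn f (Set.uIcc a b) := by
    rw [Set.uIcc_of_le hab]
    exact fun t ht => (hf t ht).continuousAt.continuousWithinAt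
  have hdiff : (∫ t in a..b, f t) - (b - a) * f a = ∫ t in a..b, (f t - f a) := by
    rw [intervalIntegral.integral_sub hcont.intervalIntegrable intervalIntegrable_const]
    simp
  have hlin : ∫ t in a..b, K * (t - a) = K * (b - a) ^ 2 / 2 := by
    rw [intervalIntegral.integral_const_mul, intervalIntegral.integral_sub (by simp) (by simp)]
    simp
    ring
  rw [hdiff, ← hlin, ← Real.norm_eq_abs]
  refine intervalIntegral.norm_integral_le_of_norm_le hab (ae_of_all _ fun t ht => ?_)
    (Continuous.intervalIntegrable (by fun_prop) _ _)
  have hmv := (convex_Icc a b).norm_image_sub_le_of_norm_hasDerivWithin_le (f := f) (f' := f')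
    (fun u hu => (hf u hu).hasDerivWithinAt) hK (Set.left_mem_Icc.2 hab)
    (Set.Ioc_subset_Icc_self ht)
  rwa [Real.norm_eq_abs (t - a), abs_of_pos (sub_pos.2 ht.1)] at hmv

open Filter Topology in
/-- The Riemann sum with step `h` of a function on `[0, ∞)` which, together with its derivative,
decays exponentially at rate `β`, differs from the integral by at most
`K h² / (2 (1 - exp (-β h)))`. -/
lemma abs_integral_Ioi_sub_riemann_sum_le {f f' : ℝ → ℝ} {β h K M : ℝ} (hβ : 0 < β) (hh : 0 < h)
    (hf : ∀ t ≥ 0, HasDerivAt f (f' t) t)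
    (hM : ∀ t ≥ 0, |f t| ≤ M * Real.exp (-β * t))
    (hK : ∀ t ≥ 0, |f' t| ≤ K * Real.exp (-β * t)) :
    |(∫ t in Set.Ioi (0 : ℝ), f t) - h * ∑' j : ℕ, f (j * h)| ≤
      K * h ^ 2 / 2 / (1 - Real.exp (-β * h)) := by
  have hK0 : 0 ≤ K := by simpa using (abs_nonneg _).trans (hK 0 le_rfl)
  have hq1 : Real.exp (-β * h) < 1 := Real.exp_lt_one_iff.2 (by nlinarith)
  have hpow (j : ℕ) : Real.exp (-β * (j * h)) = Real.exp (-β * h) ^ j := by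
    rw [← Real.exp_nat_mul]
    ring_nf
  have hcont : ContinuousOn f (Set.Ici 0) :=
    fun t ht => (hf t ht).continuousAt.continuousWithinAt
  have hint : IntegrableOn f (Set.Ioi 0) :=
    ((exp_neg_integrableOn_Ioi 0 hβ).const_mul M).mono'
      ((hcont.mono Set.Ioi_subset_Ici_self).aestronglyMeasurable measurableSet_Ioi)
      ((ae_restrict_iff' measurableSet_Ioi).2 (ae_of_all _ fun t ht => hM t (le_of_lt ht)))
  have hgeom := hasSum_geometric_of_lt_one (Real.exp_nonneg (-β * h)) hq1
  have hsum : Summable fun j : ℕ => f (j * h) :=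
    (hgeom.summable.mul_left M).of_norm_bounded fun j => by
      rw [← hpow]
      exact hM _ (by positivity)
  have hlim : Tendsto (fun n : ℕ => |(∫ t in (0 : ℝ)..n * h, f t) -
      h * ∑ j ∈ Finset.range n, f (j * h)|) atTop
      (𝓝 |(∫ t in Set.Ioi (0 : ℝ), f t) - h * ∑' j : ℕ, f (j * h)|) :=
    ((intervalIntegral_tendsto_integral_Ioi 0 hint
      (tendsto_natCast_atTop_atTop.atTop_mul_const hh)).sub
      (hsum.hasSum.tendsto_sum_nat.const_mul h)).abs
  refine le_of_tendsto hlim (Eventually.of_forall fun n => ?_)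
  have hsplit : ∑ j ∈ Finset.range n, ∫ t in (j * h : ℝ)..((j + 1 : ℕ) * h : ℝ), f t =
      ∫ t in (0 : ℝ)..n * h, f t := by
    have hadj := intervalIntegral.sum_integral_adjacent_intervals (f := f) (μ := volume)
      (a := fun j : ℕ => (j : ℝ) * h) (n := n) fun j _ => by
        refine (hcont.mono fun t ht => ?_).intervalIntegrable
        rw [Set.uIcc_of_le (by push_cast; nlinarith)] at ht
        exact le_trans (by positivity) ht.1
    simpa using hadj
  have hcell (j : ℕ) : |(∫ t in (j * h : ℝ)..((j + 1 : ℕ) * h : ℝ), f t) - h * f (j * h)| ≤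
      K * h ^ 2 / 2 * Real.exp (-β * h) ^ j := by
    have hj : (0 : ℝ) ≤ j * h := by positivity
    have hlen : ((j + 1 : ℕ) * h : ℝ) - j * h = h := by push_cast; ring
    have hleft := abs_intervalIntegral_sub_left_endpoint_le (f := f) (f' := f')
      (a := j * h) (b := (j + 1 : ℕ) * h) (K := K * Real.exp (-β * (j * h))) (by linarith)
      (fun t ht => hf t (hj.trans ht.1)) fun t ht => (hK t (hj.trans ht.1)).trans <|
        mul_le_mul_of_nonneg_left (Real.exp_le_exp.2 (by nlinarith [ht.1])) hK0
    rw [hlen, hpow] at hleft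
    exact hleft.trans_eq (by ring)
  rw [← hsplit, Finset.mul_sum, ← Finset.sum_sub_distrib]
  calc |∑ j ∈ Finset.range n, ((∫ t in (j * h : ℝ)..((j + 1 : ℕ) * h : ℝ), f t) - h * f (j * h))|
      ≤ ∑ j ∈ Finset.range n, K * h ^ 2 / 2 * Real.exp (-β * h) ^ j :=
        (Finset.abs_sum_le_sum_abs _ _).trans (Finset.sum_le_sum fun j _ => hcell j)
    _ ≤ K * h ^ 2 / 2 * (1 - Real.exp (-β * h))⁻¹ :=
        sum_le_hasSum _ (fun j _ => by positivity) (hgeom.mul_left _)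
    _ = K * h ^ 2 / 2 / (1 - Real.exp (-β * h)) := (div_eq_mul_inv _ _).symm

/-- Discretization error of the (discrete-time) Bellman equation along deterministic
dynamics (Theorem `thm:rl`, deterministic case, non-asymptotic form). -/
theorem bellman_discretization_error_deterministic {d : ℕ} (β Δt R0 RL : ℝ)
    (hβ : 0 < β) (hΔt : 0 < Δt)
    (μ : EuclideanSpace ℝ (Fin d) → EuclideanSpace ℝ (Fin d))
    (r : EuclideanSpace ℝ (Fin d) → ℝ) (hr : ContDiff ℝ 1 r)
    (hR0 : ∀ y, |r y| ≤ R0)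
    (hRL : ∀ y, |fderiv ℝ r y (μ y)| ≤ RL)
    (x : EuclideanSpace ℝ (Fin d))
    (s : ℝ → EuclideanSpace ℝ (Fin d)) (hs0 : s 0 = x)
    (hs : ∀ t ≥ (0 : ℝ), HasDerivAt s (μ (s t)) t) :
    |(∫ t in Set.Ioi (0 : ℝ), Real.exp (-β * t) * r (s t)) -
      Δt * ∑' j : ℕ, Real.exp (-β * (j * Δt)) * r (s (j * Δt))| ≤
    (1 / 2) * (β * R0 + RL) * Δt ^ 2 / (1 - Real.exp (-β * Δt)) := by
  have hderiv : ∀ t ≥ (0 : ℝ), HasDerivAt (fun t => Real.exp (-β * t) * r (s t))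
      (Real.exp (-β * t) * (-β * r (s t) + fderiv ℝ r (s t) (μ (s t)))) t := fun t ht => by
    have hrs := ((hr.differentiable one_ne_zero) (s t)).hasFDerivAt.comp_hasDerivAt t (hs t ht)
    have hexp : HasDerivAt (fun t => Real.exp (-β * t)) (Real.exp (-β * t) * -β) t := by
      simpa using ((hasDerivAt_id t).const_mul (-β)).exp
    exact (hexp.mul hrs).congr_deriv (by simp only [Function.comp_apply]; ring)
  refine (abs_integral_Ioi_sub_riemann_sum_le hβ hΔt hderiv (M := R0) (K := β * R0 + RL)
    (fun t _ => ?_) fun t _ => ?_).trans_eq (by ring)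
  · rw [abs_mul, abs_of_pos (Real.exp_pos _), mul_comm]
    exact mul_le_mul_of_nonneg_right (hR0 _) (Real.exp_nonneg _)
  · rw [abs_mul, abs_of_pos (Real.exp_pos _), mul_comm]
    refine mul_le_mul_of_nonneg_right ((abs_add_le _ _).trans (add_le_add ?_ (hRL _)))
      (Real.exp_nonneg _)
    rw [abs_mul, abs_neg, abs_of_pos hβ]
    exact mul_le_mul_of_nonneg_left (hR0 _) hβ.le
end

section
/- Let i ≥ 1 be an integer, Δt > 0, and μ : ℝ^d → ℝ^d. Suppose that for every x ∈ ℝ^d there is a trajectory s^x of μ starting at x such that t ↦ s^x(t) is (i+1)-times continuously differentiable on [0, iΔt] with ‖(d^{i+1}/dt^{i+1}) s^x(t)‖ ≤ M for all t ∈ [0, iΔt] and all x. Define μ̂_i(x) = (1/Δt) ∑_{j=1}^i a^{(i)}_j (s^x(jΔt) − x). Then sup_{x ∈ ℝ^d} ‖μ̂_i(x) − μ(x)‖ ≤ C_i M (Δt)^i. -/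
open MeasureTheory Real

/-- **Taylor's theorem** with the sharp remainder bound `C * (x - a) ^ (n + 1) / (n + 1)!` for
functions with values in a real normed space. -/
theorem norm_sub_taylorWithinEval_le_div_factorial_succ {E : Type*} [NormedAddCommGroup E]
    [NormedSpace ℝ E] {f : ℝ → E} {a b C x : ℝ} {n : ℕ} (hab : a < b)
    (hf : ContDiffOn ℝ (n + 1 : ℕ) f (Set.Icc a b)) (hx : x ∈ Set.Icc a b)
    (hC : ∀ y ∈ Set.Icc a b, ‖iteratedDerivWithin (n + 1) f (Set.Icc a b) y‖ ≤ C) :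
    ‖f x - taylorWithinEval f n (Set.Icc a b) a x‖ ≤
      C * (x - a) ^ (n + 1) / (Nat.factorial (n + 1) : ℝ) := by
  have hf' : DifferentiableOn ℝ (iteratedDerivWithin n f (Set.Icc a b)) (Set.Icc a b) :=
    hf.differentiableOn_iteratedDerivWithin (mod_cast n.lt_succ_self) (uniqueDiffOn_Icc hab)
  have hfn : ContDiffOn ℝ n f (Set.Icc a b) := hf.of_le (mod_cast n.le_succ)
  have hderiv : ∀ t ∈ Set.Icc a b,
      HasDerivWithinAt (fun y ↦ taylorWithinEval f n (Set.Icc a b) y x -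
          taylorWithinEval f n (Set.Icc a b) a x)
        (((Nat.factorial n : ℝ)⁻¹ * (x - t) ^ n) •
          iteratedDerivWithin (n + 1) f (Set.Icc a b) t) (Set.Icc a b) t := fun t ht ↦
    (hasDerivWithinAt_taylorWithinEval_at_Icc x hab ht hfn hf').sub_const _
  have hB : ∀ t, HasDerivAt
      (fun t ↦ C * ((x - a) ^ (n + 1) - (x - t) ^ (n + 1)) / (Nat.factorial (n + 1) : ℝ))
      ((Nat.factorial n : ℝ)⁻¹ * (x - t) ^ n * C) t := by
    intro t
    have h := ((((((hasDerivAt_id t).const_sub x).pow (n + 1)).const_sub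
      ((x - a) ^ (n + 1))).const_mul C).div_const (Nat.factorial (n + 1) : ℝ))
    refine h.congr_deriv ?_
    simp only [Nat.factorial_succ, Nat.cast_mul, Nat.cast_add, Nat.cast_one, id,
      Nat.add_sub_cancel]
    field_simp
  have key := image_norm_le_of_norm_deriv_right_le_deriv_boundary (a := a) (b := x)
    (fun t ht ↦ ((hderiv t ⟨ht.1, ht.2.trans hx.2⟩).continuousWithinAt).mono
      (Set.Icc_subset_Icc_right hx.2))
    (fun t ht ↦ (hderiv t ⟨ht.1, ht.2.le.trans hx.2⟩).mono_of_mem_nhdsWithin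
      (Icc_mem_nhdsGE_of_mem ⟨ht.1, ht.2.trans_le hx.2⟩))
    (by simp) hB
    (fun t ht ↦ by
      have hxt : 0 ≤ x - t := sub_nonneg.2 ht.2.le
      have hc : 0 ≤ (Nat.factorial n : ℝ)⁻¹ * (x - t) ^ n := by positivity
      rw [norm_smul, Real.norm_of_nonneg hc]
      exact mul_le_mul_of_nonneg_left (hC t ⟨ht.1, ht.2.le.trans hx.2⟩) hc)
    (Set.right_mem_Icc.2 hx.1)
  simpa using key

/-- The finite-difference estimator of the drift is an i-th order approximation
(Lemma `lemma:muhat - mu`). -/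
theorem drift_estimator_ith_order {d : ℕ} (i : ℕ) (hi : 1 ≤ i) (Δt M : ℝ) (hΔt : 0 < Δt)
    (a : ℕ → ℝ)
    (ha0 : ∀ k ≤ i, k ≠ 1 → ∑ j ∈ Finset.range (i + 1), a j * (j : ℝ) ^ k = 0)
    (ha1 : ∑ j ∈ Finset.range (i + 1), a j * (j : ℝ) = 1)
    (μ : EuclideanSpace ℝ (Fin d) → EuclideanSpace ℝ (Fin d))
    (s : EuclideanSpace ℝ (Fin d) → ℝ → EuclideanSpace ℝ (Fin d))
    (hs0 : ∀ x, s x 0 = x)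
    (hs : ∀ x, ∀ t ≥ (0 : ℝ), HasDerivAt (s x) (μ (s x t)) t)
    (hsmooth : ∀ x, ContDiffOn ℝ (i + 1 : ℕ) (s x) (Set.Icc 0 ((i : ℝ) * Δt)))
    (hM : ∀ x, ∀ t ∈ Set.Icc (0 : ℝ) ((i : ℝ) * Δt),
      ‖iteratedDerivWithin (i + 1) (s x) (Set.Icc 0 ((i : ℝ) * Δt)) t‖ ≤ M) :
    ∀ x : EuclideanSpace ℝ (Fin d),
      ‖Δt⁻¹ • ∑ j ∈ Finset.Icc 1 i, a j • (s x ((j : ℝ) * Δt) - x) - μ x‖ ≤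
      ((∑ j ∈ Finset.range (i + 1), |a j| * (j : ℝ) ^ (i + 1)) /
        (Nat.factorial (i + 1) : ℝ)) * M * Δt ^ i := by
  intro x
  have hi0 : (0 : ℝ) < i := by exact_mod_cast hi
  have hb : (0 : ℝ) < i * Δt := mul_pos hi0 hΔt
  set S := Set.Icc (0 : ℝ) ((i : ℝ) * Δt)
  have hD1 : iteratedDerivWithin 1 (s x) S 0 = μ x := by
    have h := (hs x 0 le_rfl).hasDerivWithinAt.derivWithin
      (uniqueDiffOn_Icc hb 0 (Set.left_mem_Icc.2 hb.le))
    rw [iteratedDerivWithin_one, h, hs0]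
  have hsum0 : ∑ j ∈ Finset.range (i + 1), a j = 0 := by
    simpa using ha0 0 (Nat.zero_le i) zero_ne_one
  have hshift : ∑ j ∈ Finset.Icc 1 i, a j • (s x ((j : ℝ) * Δt) - x) =
      ∑ j ∈ Finset.range (i + 1), a j • s x ((j : ℝ) * Δt) := by
    calc _ = ∑ j ∈ Finset.range (i + 1), a j • (s x ((j : ℝ) * Δt) - x) := by
          refine Finset.sum_subset (fun j hj ↦ ?_) (fun j hj hj' ↦ ?_)
          · simp only [Finset.mem_Icc, Finset.mem_range] at *
            lia
          · obtain rfl : j = 0 := by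
              simp only [Finset.mem_Icc, Finset.mem_range] at *
              lia
            simp [hs0]
      _ = _ := by
          simp only [smul_sub, Finset.sum_sub_distrib, ← Finset.sum_smul, hsum0, zero_smul,
            sub_zero]
  have htaylor : ∑ j ∈ Finset.range (i + 1), a j • taylorWithinEval (s x) i S 0 ((j : ℝ) * Δt) =
      Δt • μ x := by
    simp only [taylor_within_apply, sub_zero, Finset.smul_sum, smul_smul]
    rw [Finset.sum_comm]
    simp only [← Finset.sum_smul]
    have hcoef : ∀ k, ∑ j ∈ Finset.range (i + 1),
        a j * ((Nat.factorial k : ℝ)⁻¹ * ((j : ℝ) * Δt) ^ k) =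
        ((Nat.factorial k : ℝ)⁻¹ * Δt ^ k) *
          ∑ j ∈ Finset.range (i + 1), a j * (j : ℝ) ^ k := by
      intro k
      rw [Finset.mul_sum]
      exact Finset.sum_congr rfl fun j _ ↦ by ring
    rw [Finset.sum_eq_single 1]
    · rw [hcoef, hD1]
      simp [ha1]
    · intro k hk hk1
      rw [hcoef, ha0 k (Nat.lt_succ_iff.1 (Finset.mem_range.1 hk)) hk1, mul_zero, zero_smul]
    · intro h
      exact absurd (Finset.mem_range.2 (by lia)) h
  have herr : Δt⁻¹ • ∑ j ∈ Finset.Icc 1 i, a j • (s x ((j : ℝ) * Δt) - x) - μ x =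
      Δt⁻¹ • ∑ j ∈ Finset.range (i + 1),
        a j • (s x ((j : ℝ) * Δt) - taylorWithinEval (s x) i S 0 ((j : ℝ) * Δt)) := by
    simp only [smul_sub, Finset.sum_sub_distrib]
    rw [htaylor, inv_smul_smul₀ hΔt.ne', ← hshift]
    simp only [smul_sub, Finset.sum_sub_distrib]
  rw [herr, norm_smul, norm_inv, Real.norm_of_nonneg hΔt.le]
  calc Δt⁻¹ * ‖∑ j ∈ Finset.range (i + 1),
        a j • (s x ((j : ℝ) * Δt) - taylorWithinEval (s x) i S 0 ((j : ℝ) * Δt))‖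
      ≤ Δt⁻¹ * ∑ j ∈ Finset.range (i + 1),
        |a j| * (M * ((j : ℝ) * Δt) ^ (i + 1) / (Nat.factorial (i + 1) : ℝ)) := by
        refine mul_le_mul_of_nonneg_left (norm_sum_le_of_le _ fun j hj ↦ ?_) (by positivity)
        rw [norm_smul, Real.norm_eq_abs]
        refine mul_le_mul_of_nonneg_left ?_ (abs_nonneg _)
        have hj : (j : ℝ) ≤ i := by exact_mod_cast Nat.lt_succ_iff.1 (Finset.mem_range.1 hj)
        simpa only [sub_zero] using norm_sub_taylorWithinEval_le_div_factorial_succ hb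
          (hsmooth x) ⟨by positivity, mul_le_mul_of_nonneg_right hj hΔt.le⟩ (hM x)
    _ = _ := by
        rw [Finset.mul_sum, Finset.sum_div, Finset.sum_mul, Finset.sum_mul]
        refine Finset.sum_congr rfl fun j _ ↦ ?_
        field_simp
        ring
end

section
/- Let i ≥ 1 be an integer, Δt > 0, and let γ : ℝ → ℝ^d be (i+1)-times continuously differentiable on [0, iΔt] with ‖γ^{(i+1)}(t)‖ ≤ M for all t ∈ [0, iΔt]. Then ‖(1/Δt) ∑_{j=1}^i a^{(i)}_j (γ(jΔt) − γ(0)) − γ'(0)‖ ≤ C_i M (Δt)^i. -/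
open Real

/-- **Taylor's theorem** for vector-valued functions, with the sharp constant `1 / (n + 1)!` in the
bound on the remainder. -/
theorem norm_sub_taylorWithinEval_le {E : Type*} [NormedAddCommGroup E] [NormedSpace ℝ E]
    {f : ℝ → E} {a b C x : ℝ} {n : ℕ} (hab : a < b)
    (hf : ContDiffOn ℝ (n + 1 : ℕ) f (Set.Icc a b)) (hx : x ∈ Set.Icc a b)
    (hC : ∀ y ∈ Set.Icc a b, ‖iteratedDerivWithin (n + 1) f (Set.Icc a b) y‖ ≤ C) :
    ‖f x - taylorWithinEval f n (Set.Icc a b) a x‖ ≤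
      C * (x - a) ^ (n + 1) / ((n + 1).factorial : ℝ) := by
  have hf' : DifferentiableOn ℝ (iteratedDerivWithin n f (Set.Icc a b)) (Set.Icc a b) :=
    hf.differentiableOn_iteratedDerivWithin (mod_cast n.lt_succ_self) (uniqueDiffOn_Icc hab)
  have hfn : ContDiffOn ℝ n f (Set.Icc a b) := hf.of_le (mod_cast n.le_succ)
  have hderiv : ∀ t ∈ Set.Icc a x,
      HasDerivWithinAt
        (fun y => taylorWithinEval f n (Set.Icc a b) y x - taylorWithinEval f n (Set.Icc a b) a x)
        (((n.factorial : ℝ)⁻¹ * (x - t) ^ n) • iteratedDerivWithin (n + 1) f (Set.Icc a b) t)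
        (Set.Icc a x) t := fun t ht =>
    ((hasDerivWithinAt_taylorWithinEval_at_Icc x hab (Set.Icc_subset_Icc_right hx.2 ht)
      hfn hf').mono (Set.Icc_subset_Icc_right hx.2)).sub_const _
  have hB : ∀ t : ℝ, HasDerivAt
      (fun t => C * ((x - a) ^ (n + 1) - (x - t) ^ (n + 1)) / ((n + 1).factorial : ℝ))
      ((n.factorial : ℝ)⁻¹ * (x - t) ^ n * C) t := fun t => by
    refine ((((((hasDerivAt_id t).const_sub x).pow (n + 1)).const_sub ((x - a) ^ (n + 1))).const_mul
      C).div_const _).congr_deriv ?_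
    simp [field, Nat.factorial_succ]
  have hbound := image_norm_le_of_norm_deriv_right_le_deriv_boundary
    (fun t ht => (hderiv t ht).continuousWithinAt)
    (fun t ht => (hderiv t (Set.Ico_subset_Icc_self ht)).mono_of_mem_nhdsWithin
      (Icc_mem_nhdsGE_of_mem ht))
    (by simp) hB
    (fun t ht => by
      have hxt : 0 ≤ x - t := sub_nonneg.2 ht.2.le
      rw [norm_smul, Real.norm_of_nonneg (by positivity)]
      exact mul_le_mul_of_nonneg_left (hC t ⟨ht.1, ht.2.le.trans hx.2⟩) (by positivity))
    (Set.right_mem_Icc.2 hx.1)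
  simpa using hbound

/-- A linear functional of the samples `g (j * h)` that annihilates all monomials of degree at most
`n` except the linear one extracts the first derivative of a Taylor polynomial. -/
theorem sum_smul_taylorWithinEval_zero {E : Type*} [NormedAddCommGroup E] [NormedSpace ℝ E]
    {n : ℕ} (hn : 1 ≤ n) {a : ℕ → ℝ} (s : Finset ℕ)
    (ha0 : ∀ k ≤ n, k ≠ 1 → ∑ j ∈ s, a j * (j : ℝ) ^ k = 0)
    (ha1 : ∑ j ∈ s, a j * (j : ℝ) = 1) (f : ℝ → E) (S : Set ℝ) (h : ℝ) :
    ∑ j ∈ s, a j • taylorWithinEval f n S 0 (j * h) = h • derivWithin f S 0 := by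
  have hcoeff : ∀ k, ∑ j ∈ s, a j • (((k.factorial : ℝ)⁻¹ * ((j : ℝ) * h - 0) ^ k) •
      iteratedDerivWithin k f S 0) =
      ((∑ j ∈ s, a j * (j : ℝ) ^ k) * ((k.factorial : ℝ)⁻¹ * h ^ k)) •
        iteratedDerivWithin k f S 0 := fun k => by
    rw [Finset.sum_mul, Finset.sum_smul]
    refine Finset.sum_congr rfl fun j _ => ?_
    rw [smul_smul]
    congr 1
    ring
  simp_rw [taylor_within_apply, Finset.smul_sum]
  rw [Finset.sum_comm]
  simp_rw [hcoeff]
  rw [Finset.sum_eq_single_of_mem 1 (Finset.mem_range.2 (by lia))]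
  · simp [ha1, iteratedDerivWithin_one]
  · intro k hk hk1
    rw [ha0 k (Nat.lt_succ_iff.1 (Finset.mem_range.1 hk)) hk1, zero_mul, zero_smul]

/-- The i-th order finite-difference formula approximates the first derivative
with error `C_i M Δt^i` (core of Lemma `lemma:muhat - mu`). -/
theorem finite_difference_first_derivative {d : ℕ} (i : ℕ) (hi : 1 ≤ i) (Δt M : ℝ)
    (hΔt : 0 < Δt)
    (a : ℕ → ℝ)
    (ha0 : ∀ k ≤ i, k ≠ 1 → ∑ j ∈ Finset.range (i + 1), a j * (j : ℝ) ^ k = 0)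
    (ha1 : ∑ j ∈ Finset.range (i + 1), a j * (j : ℝ) = 1)
    (γ : ℝ → EuclideanSpace ℝ (Fin d))
    (hγ : ContDiffOn ℝ (i + 1 : ℕ) γ (Set.Icc 0 ((i : ℝ) * Δt)))
    (hM : ∀ t ∈ Set.Icc (0 : ℝ) ((i : ℝ) * Δt),
      ‖iteratedDerivWithin (i + 1) γ (Set.Icc 0 ((i : ℝ) * Δt)) t‖ ≤ M) :
    ‖Δt⁻¹ • ∑ j ∈ Finset.Icc 1 i, a j • (γ ((j : ℝ) * Δt) - γ 0) -
        derivWithin γ (Set.Icc 0 ((i : ℝ) * Δt)) 0‖ ≤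
    ((∑ j ∈ Finset.range (i + 1), |a j| * (j : ℝ) ^ (i + 1)) /
      (Nat.factorial (i + 1) : ℝ)) * M * Δt ^ i := by
  set S := Set.Icc (0 : ℝ) ((i : ℝ) * Δt)
  have hpos : 0 < (i : ℝ) * Δt := mul_pos (by exact_mod_cast hi) hΔt
  have hsum : ∑ j ∈ Finset.range (i + 1), a j = 0 := by simpa using ha0 0 (Nat.zero_le i) (by simp)
  have hsamples : ∑ j ∈ Finset.Icc 1 i, a j • (γ ((j : ℝ) * Δt) - γ 0) =
      ∑ j ∈ Finset.range (i + 1), a j • γ ((j : ℝ) * Δt) := by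
    have hsub : Finset.Icc 1 i ⊆ Finset.range (i + 1) := fun j hj => by
      simp only [Finset.mem_Icc, Finset.mem_range] at hj ⊢
      lia
    rw [Finset.sum_subset hsub]
    · simp_rw [smul_sub]
      rw [Finset.sum_sub_distrib, ← Finset.sum_smul, hsum, zero_smul, sub_zero]
    · intro j hj hj'
      have hj0 : j = 0 := by
        simp only [Finset.mem_Icc, Finset.mem_range] at hj hj'
        lia
      simp [hj0]
  have herror : Δt⁻¹ • ∑ j ∈ Finset.Icc 1 i, a j • (γ ((j : ℝ) * Δt) - γ 0) -
      derivWithin γ S 0 = Δt⁻¹ • ∑ j ∈ Finset.range (i + 1),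
        a j • (γ ((j : ℝ) * Δt) - taylorWithinEval γ i S 0 (j * Δt)) := by
    simp_rw [hsamples, smul_sub (a _)]
    rw [Finset.sum_sub_distrib, sum_smul_taylorWithinEval_zero hi _ ha0 ha1, smul_sub,
      inv_smul_smul₀ hΔt.ne']
  rw [herror, norm_smul, Real.norm_of_nonneg (inv_nonneg.2 hΔt.le)]
  calc Δt⁻¹ * ‖∑ j ∈ Finset.range (i + 1),
        a j • (γ ((j : ℝ) * Δt) - taylorWithinEval γ i S 0 (j * Δt))‖
      ≤ Δt⁻¹ * ∑ j ∈ Finset.range (i + 1),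
          |a j| * (M * ((j : ℝ) * Δt - 0) ^ (i + 1) / ((i + 1).factorial : ℝ)) := by
        refine mul_le_mul_of_nonneg_left (norm_sum_le_of_le _ fun j hj => ?_)
          (inv_nonneg.2 hΔt.le)
        rw [norm_smul, Real.norm_eq_abs]
        have hji : (j : ℝ) ≤ i := by exact_mod_cast Nat.lt_succ_iff.1 (Finset.mem_range.1 hj)
        exact mul_le_mul_of_nonneg_left (norm_sub_taylorWithinEval_le hpos hγ
          ⟨by positivity, mul_le_mul_of_nonneg_right hji hΔt.le⟩ hM) (abs_nonneg _)
    _ = ((∑ j ∈ Finset.range (i + 1), |a j| * (j : ℝ) ^ (i + 1)) /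
          (Nat.factorial (i + 1) : ℝ)) * M * Δt ^ i := by
        simp_rw [Finset.sum_div, Finset.sum_mul, Finset.mul_sum]
        refine Finset.sum_congr rfl fun j _ => ?_
        field_simp
        ring
end

section
/- Let β > 0, Δt > 0, let μ : ℝ^d → ℝ^d, let r : ℝ^d → ℝ be continuously differentiable with ‖r‖_∞ ≤ R₀ and sup_x |⟨μ(x), ∇r(x)⟩| ≤ R_L, and let s be a trajectory of μ starting at x ∈ ℝ^d. Then |(1/Δt) ∫₀^{Δt} e^{−βt} r(s(t)) dt − r(x)| ≤ ½ (β R₀ + R_L) Δt. -/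
open MeasureTheory Real intervalIntegral

/-- The mean of a function over `[0, h]` differs from its value at `0` by at most half of `h` times
a bound on its derivative. -/
theorem abs_average_sub_le_of_abs_deriv_le {g g' : ℝ → ℝ} {C h : ℝ} (hh : 0 < h)
    (hg : ∀ t ∈ Set.Icc 0 h, HasDerivAt g (g' t) t) (hC : ∀ t ∈ Set.Icc 0 h, |g' t| ≤ C) :
    |h⁻¹ * (∫ t in (0 : ℝ)..h, g t) - g 0| ≤ 1 / 2 * C * h := by
  have growth : ∀ t ∈ Set.Icc 0 h, ‖g t - g 0‖ ≤ C * (t - 0) :=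
    norm_image_sub_le_of_norm_deriv_le_segment' (fun t ht => (hg t ht).hasDerivWithinAt)
      fun t ht => hC t (Set.Ico_subset_Icc_self ht)
  have integrable : IntervalIntegrable g volume 0 h :=
    ContinuousOn.intervalIntegrable_of_Icc hh.le
      fun t ht => (hg t ht).continuousAt.continuousWithinAt
  have integral_bound : ‖∫ t in (0 : ℝ)..h, (g t - g 0)‖ ≤ ∫ t in (0 : ℝ)..h, C * (t - 0) :=
    norm_integral_le_of_norm_le hh.le
      (Filter.Eventually.of_forall fun t ht => growth t (Set.Ioc_subset_Icc_self ht))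
      (Continuous.intervalIntegrable (by fun_prop) _ _)
  have average_eq : h⁻¹ * (∫ t in (0 : ℝ)..h, g t) - g 0 =
      h⁻¹ * ∫ t in (0 : ℝ)..h, (g t - g 0) := by
    rw [integral_sub integrable intervalIntegrable_const, intervalIntegral.integral_const, smul_eq_mul]
    field_simp
    ring
  have integral_linear : ∫ t in (0 : ℝ)..h, C * (t - 0) = C * (h ^ 2 / 2) := by
    rw [intervalIntegral.integral_const_mul]
    simp [integral_id]
  rw [integral_linear, Real.norm_eq_abs] at integral_bound
  rw [average_eq, abs_mul, abs_of_pos (inv_pos.2 hh)]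
  calc h⁻¹ * |∫ t in (0 : ℝ)..h, (g t - g 0)| ≤ h⁻¹ * (C * (h ^ 2 / 2)) := by gcongr
    _ = 1 / 2 * C * h := by field_simp

/-- One-step reward approximation error (inequality `rlerror`, deterministic case). -/
theorem one_step_reward_error {d : ℕ} (β Δt R0 RL : ℝ) (hβ : 0 < β) (hΔt : 0 < Δt)
    (μ : EuclideanSpace ℝ (Fin d) → EuclideanSpace ℝ (Fin d))
    (r : EuclideanSpace ℝ (Fin d) → ℝ) (hr : ContDiff ℝ 1 r)
    (hR0 : ∀ y, |r y| ≤ R0)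
    (hRL : ∀ y, |fderiv ℝ r y (μ y)| ≤ RL)
    (x : EuclideanSpace ℝ (Fin d))
    (s : ℝ → EuclideanSpace ℝ (Fin d)) (hs0 : s 0 = x)
    (hs : ∀ t ≥ (0 : ℝ), HasDerivAt s (μ (s t)) t) :
    |Δt⁻¹ * (∫ t in (0 : ℝ)..Δt, Real.exp (-β * t) * r (s t)) - r x| ≤
    (1 / 2) * (β * R0 + RL) * Δt := by
  have hderiv : ∀ t ∈ Set.Icc 0 Δt, HasDerivAt (fun t => Real.exp (-β * t) * r (s t))
      (Real.exp (-β * t) * (-β) * r (s t) + Real.exp (-β * t) * fderiv ℝ r (s t) (μ (s t))) t := by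
    intro t ht
    have hexp : HasDerivAt (fun t => Real.exp (-β * t)) (Real.exp (-β * t) * (-β)) t := by
      simpa using ((hasDerivAt_id t).const_mul (-β)).exp
    exact hexp.mul
      (((hr.differentiable one_ne_zero) (s t)).hasFDerivAt.comp_hasDerivAt t (hs t ht.1))
  have hbound : ∀ t ∈ Set.Icc 0 Δt,
      |Real.exp (-β * t) * (-β) * r (s t) + Real.exp (-β * t) * fderiv ℝ r (s t) (μ (s t))| ≤
        β * R0 + RL := by
    intro t ht
    have hexp : Real.exp (-β * t) ≤ 1 :=
      Real.exp_le_one_iff.2 (by nlinarith [ht.1])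
    rw [mul_assoc, ← mul_add, abs_mul, Real.abs_exp]
    refine (mul_le_of_le_one_left (abs_nonneg _) hexp).trans ((abs_add_le _ _).trans ?_)
    rw [abs_mul, abs_neg, abs_of_pos hβ]
    gcongr
    · exact hR0 _
    · exact hRL _
  simpa [hs0] using abs_average_sub_le_of_abs_deriv_le hΔt hderiv hbound
end

section
/- Let μ : ℝ^d → ℝ^d be continuous, let Σ : ℝ^d → ℝ^{d×d} be continuous with Σ(x) symmetric and Σ(x) ⪰ λ_min I for all x and some λ_min > 0, and let ρ be a nonnegative locally integrable weight on ℝ^d that is stationary for (μ,Σ). Then for every V ∈ C_c^∞(ℝ^d), ⟨L_{μ,Σ}V, V⟩_ρ ≤ −(λ_min/2) ‖∇V‖_ρ², where ‖∇V‖_ρ² = ∫ ‖∇V(x)‖² ρ(x) dx. -/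
open MeasureTheory Real
open scoped RealInnerProductSpace

/-- The infinitesimal generator `L_{μ,Σ} f = μ·∇f + ½ Σ : ∇²f`. -/
noncomputable def genOp {d : ℕ} (μ : EuclideanSpace ℝ (Fin d) → EuclideanSpace ℝ (Fin d))
    (Sig : EuclideanSpace ℝ (Fin d) → Fin d → Fin d → ℝ)
    (f : EuclideanSpace ℝ (Fin d) → ℝ) (x : EuclideanSpace ℝ (Fin d)) : ℝ :=
  ⟪μ x, gradient f x⟫ +
    (1 / 2) * ∑ i : Fin d, ∑ j : Fin d, Sig x i j *
      fderiv ℝ (fun y => fderiv ℝ f y (EuclideanSpace.single j 1)) x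
        (EuclideanSpace.single i 1)

theorem inner_gradient_eq_fderiv {d : ℕ} (f : EuclideanSpace ℝ (Fin d) → ℝ)
    (x v : EuclideanSpace ℝ (Fin d)) : ⟪v, gradient f x⟫ = fderiv ℝ f x v := by
  rw [real_inner_comm, gradient, InnerProductSpace.toDual_symm_apply]

theorem norm_gradient_sq_eq_sum {d : ℕ} (f : EuclideanSpace ℝ (Fin d) → ℝ)
    (x : EuclideanSpace ℝ (Fin d)) :
    ‖gradient f x‖ ^ 2 = ∑ i, fderiv ℝ f x (EuclideanSpace.single i 1) ^ 2 := by
  rw [EuclideanSpace.real_norm_sq_eq]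
  refine Finset.sum_congr rfl fun i _ => ?_
  rw [← inner_gradient_eq_fderiv, EuclideanSpace.inner_single_left]
  simp

/-- The squared gradient `∇f · Σ ∇f` (carré du champ) of the generator. -/
noncomputable def carreDuChamp {d : ℕ}
    (Sig : EuclideanSpace ℝ (Fin d) → Fin d → Fin d → ℝ)
    (f : EuclideanSpace ℝ (Fin d) → ℝ) (x : EuclideanSpace ℝ (Fin d)) : ℝ :=
  ∑ i, ∑ j, fderiv ℝ f x (EuclideanSpace.single i 1) * Sig x i j *
    fderiv ℝ f x (EuclideanSpace.single j 1)

theorem contDiff_fderiv_apply_const {d : ℕ} {f : EuclideanSpace ℝ (Fin d) → ℝ}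
    (hf : ContDiff ℝ (⊤ : ℕ∞) f) (v : EuclideanSpace ℝ (Fin d)) :
    ContDiff ℝ (⊤ : ℕ∞) fun x => fderiv ℝ f x v :=
  (hf.fderiv_right (by simp)).clm_apply contDiff_const

theorem genOp_sq {d : ℕ} (μ : EuclideanSpace ℝ (Fin d) → EuclideanSpace ℝ (Fin d))
    (Sig : EuclideanSpace ℝ (Fin d) → Fin d → Fin d → ℝ)
    {f : EuclideanSpace ℝ (Fin d) → ℝ} (hf : ContDiff ℝ (⊤ : ℕ∞) f)
    (x : EuclideanSpace ℝ (Fin d)) :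
    genOp μ Sig (fun y => f y * f y) x = 2 * (genOp μ Sig f x * f x) + carreDuChamp Sig f x := by
  have hd : Differentiable ℝ f := hf.differentiable (by simp)
  have h1 : ∀ v y, fderiv ℝ (fun y => f y * f y) y v = 2 * f y * fderiv ℝ f y v := fun v y => by
    rw [fderiv_fun_mul (hd y) (hd y)]
    simp only [add_apply, smul_apply, smul_eq_mul]
    ring
  have h2 : ∀ v w, fderiv ℝ (fun y => 2 * f y * fderiv ℝ f y v) x w =
      2 * f x * fderiv ℝ (fun y => fderiv ℝ f y v) x w
        + 2 * (fderiv ℝ f x w * fderiv ℝ f x v) := fun v w => by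
    rw [fderiv_fun_mul ((hd x).const_mul 2)
      ((contDiff_fderiv_apply_const hf v).differentiable (by simp) x),
      fderiv_const_mul (hd x)]
    simp only [add_apply, smul_apply, smul_eq_mul]
    ring
  simp only [genOp, carreDuChamp, inner_gradient_eq_fderiv, h1, h2]
  have h3 : ∀ s b v w : ℝ, s * (2 * f x * b + 2 * (v * w)) = 2 * f x * (s * b) + 2 * (v * s * w) :=
    fun s b v w => by ring
  simp only [h3, Finset.sum_add_distrib, ← Finset.mul_sum]
  ring

theorem continuous_genOp {d : ℕ} {μ : EuclideanSpace ℝ (Fin d) → EuclideanSpace ℝ (Fin d)}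
    (hμ : Continuous μ) {Sig : EuclideanSpace ℝ (Fin d) → Fin d → Fin d → ℝ}
    (hSig : ∀ i j, Continuous fun x => Sig x i j)
    {f : EuclideanSpace ℝ (Fin d) → ℝ} (hf : ContDiff ℝ (⊤ : ℕ∞) f) :
    Continuous (genOp μ Sig f) := by
  unfold genOp
  simp only [inner_gradient_eq_fderiv]
  refine ((hf.continuous_fderiv (by simp)).clm_apply hμ).add (continuous_const.mul ?_)
  exact continuous_finsetSum _ fun i _ => continuous_finsetSum _ fun j _ => (hSig i j).mul
    (contDiff_fderiv_apply_const (contDiff_fderiv_apply_const hf _) _).continuous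

theorem integrable_mul_of_hasCompactSupport {d : ℕ} {ρ g : EuclideanSpace ℝ (Fin d) → ℝ}
    (hρ : LocallyIntegrable ρ) (hg : Continuous g) (hgs : HasCompactSupport g) :
    Integrable fun x => g x * ρ x :=
  hρ.integrable_smul_left_of_hasCompactSupport hg hgs

/-- Coercivity of the generator in the weighted `L²` norm
(first inequality of Proposition `lemma:l2 operator`, stationary case). -/
theorem generator_coercivity {d : ℕ} (lammin : ℝ) (hlammin : 0 < lammin)
    (μ : EuclideanSpace ℝ (Fin d) → EuclideanSpace ℝ (Fin d)) (hμ : Continuous μ)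
    (Sig : EuclideanSpace ℝ (Fin d) → Fin d → Fin d → ℝ)
    (hSigCont : ∀ i j, Continuous fun x => Sig x i j)
    (hSigSymm : ∀ x i j, Sig x i j = Sig x j i)
    (hSigPos : ∀ x (v : Fin d → ℝ),
      lammin * ∑ i, v i ^ 2 ≤ ∑ i, ∑ j, v i * Sig x i j * v j)
    (ρ : EuclideanSpace ℝ (Fin d) → ℝ) (hρ : ∀ x, 0 ≤ ρ x)
    (hρloc : LocallyIntegrable ρ)
    (hstat : ∀ φ : EuclideanSpace ℝ (Fin d) → ℝ, ContDiff ℝ (⊤ : ℕ∞) φ → HasCompactSupport φ →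
      ∫ x, genOp μ Sig φ x * ρ x = 0)
    (V : EuclideanSpace ℝ (Fin d) → ℝ) (hV : ContDiff ℝ (⊤ : ℕ∞) V)
    (hVsupp : HasCompactSupport V) :
    ∫ x, genOp μ Sig V x * V x * ρ x ≤
      -(lammin / 2) * ∫ x, ‖gradient V x‖ ^ 2 * ρ x := by
  have hdc : ∀ v, Continuous fun x => fderiv ℝ V x v := fun v =>
    (contDiff_fderiv_apply_const hV v).continuous
  have hds : ∀ v, HasCompactSupport fun x => fderiv ℝ V x v := fun v =>
    hVsupp.fderiv_apply ℝ v
  have hLV : Integrable fun x => genOp μ Sig V x * V x * ρ x :=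
    integrable_mul_of_hasCompactSupport hρloc ((continuous_genOp hμ hSigCont hV).mul hV.continuous)
      hVsupp.mul_left
  have hΓ : Integrable fun x => carreDuChamp Sig V x * ρ x := by
    simp only [carreDuChamp, Finset.sum_mul]
    exact integrable_finsetSum _ fun i _ => integrable_finsetSum _ fun j _ =>
      integrable_mul_of_hasCompactSupport hρloc (((hdc _).mul (hSigCont i j)).mul (hdc _))
        (hds _).mul_left
  have hgrad : Integrable fun x => ‖gradient V x‖ ^ 2 * ρ x := by
    simp only [norm_gradient_sq_eq_sum, Finset.sum_mul]
    simp only [pow_two]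
    exact integrable_finsetSum _ fun i _ =>
      integrable_mul_of_hasCompactSupport hρloc ((hdc _).mul (hdc _)) (hds _).mul_left
  have hsq : 2 * ∫ x, genOp μ Sig V x * V x * ρ x = -∫ x, carreDuChamp Sig V x * ρ x := by
    have h := hstat (fun y => V y * V y) (hV.mul hV) hVsupp.mul_left
    simp only [genOp_sq μ Sig hV, add_mul, mul_assoc (2 : ℝ)] at h
    rw [integral_add (hLV.const_mul 2) hΓ, integral_const_mul] at h
    linarith
  have hle : lammin * ∫ x, ‖gradient V x‖ ^ 2 * ρ x ≤ ∫ x, carreDuChamp Sig V x * ρ x := by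
    rw [← integral_const_mul]
    refine integral_mono (hgrad.const_mul _) hΓ fun x => ?_
    simp only [← mul_assoc, norm_gradient_sq_eq_sum]
    exact mul_le_mul_of_nonneg_right (hSigPos x _) (hρ x)
  linarith
end

section
/- Let β > 0, let μ : ℝ^d → ℝ^d be continuous, let Σ : ℝ^d → ℝ^{d×d} be continuously differentiable with Σ(x) symmetric and Σ(x) ⪰ λ_min I for all x and some λ_min > 0, and let ρ be a strictly positive continuously differentiable probability density on ℝ^d satisfying ‖−μ + ½∇·Σ + ½Σ∇log ρ‖_∞² ≤ ½ β λ_min. Then for every V ∈ C_c^∞(ℝ^d), ⟨L_{μ,Σ}V, V⟩_ρ ≤ (β/2) ‖V‖_ρ² − (λ_min/4) ‖∇V‖_ρ². -/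
open MeasureTheory Real
open scoped RealInnerProductSpace

theorem integral_fderiv_apply_eq_zero {E : Type*} [NormedAddCommGroup E] [NormedSpace ℝ E]
    [FiniteDimensional ℝ E] [MeasurableSpace E] [BorelSpace E] (ν : Measure E)
    [ν.IsAddHaarMeasure] {f : E → ℝ} (hf : ContDiff ℝ 1 f) (hfs : HasCompactSupport f) (v : E) :
    ∫ x, fderiv ℝ f x v ∂ν = 0 := by
  have hint : Integrable (fun x => fderiv ℝ f x v) ν :=
    ((hf.continuous_fderiv one_ne_zero).clm_apply
      continuous_const).integrable_of_hasCompactSupport (hfs.fderiv_apply ℝ v)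
  have hint' : Integrable f ν := hf.continuous.integrable_of_hasCompactSupport hfs
  have h := integral_mul_fderiv_eq_neg_fderiv_mul_of_integrable (μ := ν) (f := fun _ => (1 : ℝ))
    (g := f) (v := v) (by simp) (by simpa using hint) (by simpa using hint')
    (fun _ _ => differentiableAt_const _) (fun x _ => hf.differentiable one_ne_zero x)
  simpa using h

theorem fderiv_half_sum_mul_apply {ι E : Type*} [Fintype ι] [NormedAddCommGroup E]
    [NormedSpace ℝ E] {s t : ι → E → ℝ} {p q : E → ℝ} {x : E}
    (hs : ∀ j, DifferentiableAt ℝ (s j) x) (ht : ∀ j, DifferentiableAt ℝ (t j) x)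
    (hp : DifferentiableAt ℝ p x) (hq : DifferentiableAt ℝ q x) (u : E) :
    fderiv ℝ (fun y => (1 / 2) * ((∑ j, s j y * t j y) * (p y * q y))) x u =
      (1 / 2) * ((∑ j, (fderiv ℝ (s j) x u * t j x + s j x * fderiv ℝ (t j) x u)) * (p x * q x) +
        (∑ j, s j x * t j x) * (fderiv ℝ p x u * q x + p x * fderiv ℝ q x u)) := by
  have h := ((HasFDerivAt.fun_sum (u := Finset.univ)
    fun j _ => (hs j).hasFDerivAt.fun_mul (ht j).hasFDerivAt).fun_mul
    (hp.hasFDerivAt.fun_mul hq.hasFDerivAt)).const_mul (1 / 2 : ℝ)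
  rw [h.fderiv]
  simp only [add_apply, smul_apply, smul_eq_mul, sum_apply]
  rw [Finset.sum_congr rfl fun j _ => show
    fderiv ℝ (s j) x u * t j x + s j x * fderiv ℝ (t j) x u =
      s j x * fderiv ℝ (t j) x u + t j x * fderiv ℝ (s j) x u by ring]
  ring

theorem gradient_apply_eq_fderiv_single {d : ℕ} (f : EuclideanSpace ℝ (Fin d) → ℝ)
    (x : EuclideanSpace ℝ (Fin d)) (i : Fin d) :
    gradient f x i = fderiv ℝ f x (EuclideanSpace.single i 1) := by
  rw [← inner_gradient_left, EuclideanSpace.inner_single_right]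
  simp

/-- The product rule expansion of the divergence of `½ v w S g`, with `T i j = ∂ᵢ S i j`,
`H i j = ∂ᵢ gⱼ`, `g = ∇v` and `r = ∇w`. -/
theorem generator_mul_eq_divergence_sub {ι : Type*} [Fintype ι] (S T H : ι → ι → ℝ)
    (m g r b : ι → ℝ) (v w : ℝ) (hw : w ≠ 0) (hS : ∀ i j, S i j = S j i)
    (hb : ∀ i, b i = -m i + (1 / 2) * ∑ l, T l i + (1 / 2) * ∑ j, S i j * (r j / w)) :
    (∑ i, m i * g i + (1 / 2) * ∑ i, ∑ j, S i j * H i j) * v * w =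
      (∑ i, (1 / 2) * ((∑ j, (T i j * g j + S i j * H i j)) * (v * w) +
        (∑ j, S i j * g j) * (g i * w + v * r i))) -
      (∑ i, b i * g i) * v * w - (1 / 2) * (∑ i, ∑ j, g i * S i j * g j) * w := by
  have hT : ∑ i, (∑ l, T l i) * g i = ∑ i, ∑ j, T i j * g j := by
    simp_rw [Finset.sum_mul]
    exact Finset.sum_comm
  have hr : ∑ i, (∑ j, S i j * (r j / w)) * g i * w = ∑ i, (∑ j, S i j * g j) * r i := by
    simp_rw [Finset.sum_mul]
    rw [Finset.sum_comm]
    refine Finset.sum_congr rfl fun i _ => Finset.sum_congr rfl fun j _ => ?_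
    rw [hS j i]
    field_simp
  have hg : ∑ i, (∑ j, S i j * g j) * g i = ∑ i, ∑ j, g i * S i j * g j := by
    simp_rw [Finset.sum_mul]
    exact Finset.sum_congr rfl fun i _ => Finset.sum_congr rfl fun j _ => by ring
  have hbg : (∑ i, b i * g i) * w = -(∑ i, m i * g i) * w +
      (1 / 2) * (∑ i, ∑ j, T i j * g j) * w + (1 / 2) * ∑ i, (∑ j, S i j * g j) * r i := by
    rw [← hT, ← hr]
    simp_rw [hb, Finset.sum_mul, Finset.mul_sum, ← Finset.sum_neg_distrib, Finset.sum_mul,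
      ← Finset.sum_add_distrib]
    refine Finset.sum_congr rfl fun i _ => ?_
    simp_rw [add_mul, Finset.sum_mul]
    simp only [mul_assoc, neg_mul]
  have hdiv : ∑ i, (1 / 2) * ((∑ j, (T i j * g j + S i j * H i j)) * (v * w) +
        (∑ j, S i j * g j) * (g i * w + v * r i)) =
      (1 / 2) * ((∑ i, ∑ j, T i j * g j) + ∑ i, ∑ j, S i j * H i j) * (v * w) +
        (1 / 2) * (∑ i, (∑ j, S i j * g j) * g i) * w +
        (1 / 2) * v * ∑ i, (∑ j, S i j * g j) * r i := by
    rw [← Finset.sum_add_distrib, Finset.mul_sum, Finset.mul_sum, Finset.mul_sum, Finset.sum_mul,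
      Finset.sum_mul, ← Finset.sum_add_distrib, ← Finset.sum_add_distrib]
    refine Finset.sum_congr rfl fun i _ => ?_
    rw [Finset.sum_add_distrib]
    ring
  rw [hdiv, hg]
  linear_combination v * hbg

theorem neg_inner_mul_le_of_norm_sq_le {F : Type*} [NormedAddCommGroup F] [InnerProductSpace ℝ F]
    {β c : ℝ} (hc : 0 < c) (b g : F) (hb : ‖b‖ ^ 2 ≤ β * c / 2) (v : ℝ) :
    -(⟪b, g⟫ * v) ≤ (β / 2) * v ^ 2 + (c / 4) * ‖g‖ ^ 2 := by
  have h1 : -(⟪b, g⟫ * v) ≤ ‖b‖ * ‖g‖ * |v| := by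
    refine (neg_le_abs _).trans ?_
    rw [abs_mul]
    gcongr
    exact abs_real_inner_le_norm b g
  have h2 : ‖b‖ ^ 2 * v ^ 2 ≤ β * c / 2 * v ^ 2 := by gcongr
  have h3 := sq_nonneg (c * ‖g‖ - 2 * ‖b‖ * |v|)
  have h4 : c * (‖b‖ * ‖g‖ * |v|) ≤ c * ((β / 2) * v ^ 2 + (c / 4) * ‖g‖ ^ 2) := by
    nlinarith [sq_abs v]
  exact h1.trans (le_of_mul_le_mul_left h4 hc)

/-- Pointwise, `(L V) V ρ` is at most the divergence of `½ V ρ Σ∇V` plus the coercive terms. -/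
theorem genOp_mul_le_divergence_add {d : ℕ} {β lammin : ℝ} (hlammin : 0 < lammin)
    {μ : EuclideanSpace ℝ (Fin d) → EuclideanSpace ℝ (Fin d)}
    {Sig : EuclideanSpace ℝ (Fin d) → Fin d → Fin d → ℝ}
    (hSigC1 : ∀ i j, ContDiff ℝ 1 fun x => Sig x i j)
    (hSigSymm : ∀ x i j, Sig x i j = Sig x j i)
    (hSigPos : ∀ x (v : Fin d → ℝ),
      lammin * ∑ i, v i ^ 2 ≤ ∑ i, ∑ j, v i * Sig x i j * v j)
    {ρ : EuclideanSpace ℝ (Fin d) → ℝ} (hρpos : ∀ x, 0 < ρ x) (hρC1 : ContDiff ℝ 1 ρ)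
    (hcond : ∀ x : EuclideanSpace ℝ (Fin d),
      ‖(WithLp.equiv 2 (Fin d → ℝ)).symm (fun i =>
        -(μ x i) +
        (1 / 2) * ∑ l, fderiv ℝ (fun y => Sig y i l) x (EuclideanSpace.single l 1) +
        (1 / 2) * ∑ j, Sig x i j *
          fderiv ℝ (fun y => Real.log (ρ y)) x (EuclideanSpace.single j 1))‖ ^ 2 ≤
      β * lammin / 2)
    {V : EuclideanSpace ℝ (Fin d) → ℝ} (hV : ContDiff ℝ 2 V) (x : EuclideanSpace ℝ (Fin d)) :
    genOp μ Sig V x * V x * ρ x ≤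
      (∑ i, fderiv ℝ (fun y => (1 / 2) * ((∑ j, Sig y i j *
        fderiv ℝ V y (EuclideanSpace.single j 1)) * (V y * ρ y))) x (EuclideanSpace.single i 1)) +
      ((β / 2) * (V x ^ 2 * ρ x) - (lammin / 4) * (‖gradient V x‖ ^ 2 * ρ x)) := by
  let e : Fin d → EuclideanSpace ℝ (Fin d) := fun i => EuclideanSpace.single i 1
  have hV1 : ContDiff ℝ 1 V := hV.of_le one_le_two
  have hdV : ∀ j, ContDiff ℝ 1 fun x => fderiv ℝ V x (e j) := fun j =>
    (hV.fderiv_right (m := 1) one_add_one_eq_two.le).clm_apply contDiff_const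
  have hdiv : ∀ i, fderiv ℝ (fun y => (1 / 2) * ((∑ j, Sig y i j *
      fderiv ℝ V y (EuclideanSpace.single j 1)) * (V y * ρ y))) x (EuclideanSpace.single i 1) =
      (1 / 2) * ((∑ j, (fderiv ℝ (fun y => Sig y i j) x (e i) * fderiv ℝ V x (e j) +
        Sig x i j * fderiv ℝ (fun y => fderiv ℝ V y (e j)) x (e i))) * (V x * ρ x) +
        (∑ j, Sig x i j * fderiv ℝ V x (e j)) *
          (fderiv ℝ V x (e i) * ρ x + V x * fderiv ℝ ρ x (e i))) :=
    fun i => fderiv_half_sum_mul_apply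
      (fun j => (hSigC1 i j).differentiable one_ne_zero x)
      (fun j => (hdV j).differentiable one_ne_zero x) (hV1.differentiable one_ne_zero x)
      (hρC1.differentiable one_ne_zero x) (e i)
  have hlog : ∀ j, fderiv ℝ (fun y => Real.log (ρ y)) x (e j) = fderiv ℝ ρ x (e j) / ρ x := by
    intro j
    rw [((hρC1.differentiable one_ne_zero x).hasFDerivAt.log (hρpos x).ne').fderiv]
    simp [div_eq_inv_mul]
  obtain ⟨b, hbdef⟩ : ∃ b : EuclideanSpace ℝ (Fin d), b =
      (WithLp.equiv 2 (Fin d → ℝ)).symm (fun i => -(μ x i) +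
        (1 / 2) * ∑ l, fderiv ℝ (fun y => Sig y i l) x (EuclideanSpace.single l 1) +
        (1 / 2) * ∑ j, Sig x i j *
          fderiv ℝ (fun y => Real.log (ρ y)) x (EuclideanSpace.single j 1)) := ⟨_, rfl⟩
  have hb : ‖b‖ ^ 2 ≤ β * lammin / 2 := hbdef ▸ hcond x
  have hbi : ∀ i, b i = -μ x i +
      (1 / 2) * ∑ l, fderiv ℝ (fun y => Sig y l i) x (e l) +
      (1 / 2) * ∑ j, Sig x i j * (fderiv ℝ ρ x (e j) / ρ x) := by
    intro i
    simp_rw [← hlog, fun y l => hSigSymm y l i]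
    rw [hbdef]
    rfl
  have hinner : ∀ a : EuclideanSpace ℝ (Fin d),
      ⟪a, gradient V x⟫ = ∑ i, a i * fderiv ℝ V x (e i) := by
    intro a
    simp only [e, ← gradient_apply_eq_fderiv_single, PiLp.inner_apply, RCLike.inner_apply,
      conj_trivial, mul_comm]
  have hkey := generator_mul_eq_divergence_sub (Sig x)
    (fun i j => fderiv ℝ (fun y => Sig y i j) x (e i))
    (fun i j => fderiv ℝ (fun y => fderiv ℝ V y (e j)) x (e i)) (μ x)
    (fun i => fderiv ℝ V x (e i)) (fun i => fderiv ℝ ρ x (e i)) b (V x) (ρ x)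
    (hρpos x).ne' (hSigSymm x) hbi
  have hquad := hSigPos x (fun i => fderiv ℝ V x (e i))
  have hnorm : ‖gradient V x‖ ^ 2 = ∑ i, fderiv ℝ V x (e i) ^ 2 := by
    simp only [EuclideanSpace.norm_sq_eq, gradient_apply_eq_fderiv_single, e, Real.norm_eq_abs,
      sq_abs]
  rw [← hnorm] at hquad
  have hcs := neg_inner_mul_le_of_norm_sq_le hlammin b (gradient V x) hb (V x)
  rw [← hinner, ← hinner] at hkey
  simp_rw [hdiv]
  have hle := mul_le_mul_of_nonneg_right
    (add_le_add hcs (mul_le_mul_of_nonneg_left hquad (by norm_num : (0 : ℝ) ≤ 1 / 2)))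
    (hρpos x).le
  have hgen : genOp μ Sig V x = ⟪μ x, gradient V x⟫ + (1 / 2) * ∑ i, ∑ j, Sig x i j *
      fderiv ℝ (fun y => fderiv ℝ V y (e j)) x (e i) := rfl
  rw [hgen, hkey]
  linarith

/-- Coercivity of the generator in the weighted `L²` norm for a non-stationary weight
satisfying the smallness condition `def of new rho`
(first inequality of Proposition `lemma:l2 operator`, non-stationary case). -/
theorem generator_coercivity_nonstationary {d : ℕ} (β lammin : ℝ)
    (hβ : 0 < β) (hlammin : 0 < lammin)
    (μ : EuclideanSpace ℝ (Fin d) → EuclideanSpace ℝ (Fin d)) (hμ : Continuous μ)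
    (Sig : EuclideanSpace ℝ (Fin d) → Fin d → Fin d → ℝ)
    (hSigC1 : ∀ i j, ContDiff ℝ 1 fun x => Sig x i j)
    (hSigSymm : ∀ x i j, Sig x i j = Sig x j i)
    (hSigPos : ∀ x (v : Fin d → ℝ),
      lammin * ∑ i, v i ^ 2 ≤ ∑ i, ∑ j, v i * Sig x i j * v j)
    (ρ : EuclideanSpace ℝ (Fin d) → ℝ) (hρpos : ∀ x, 0 < ρ x)
    (hρC1 : ContDiff ℝ 1 ρ) (hρprob : ∫ x, ρ x = 1)
    (hcond : ∀ x : EuclideanSpace ℝ (Fin d),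
      ‖(WithLp.equiv 2 (Fin d → ℝ)).symm (fun i =>
        -(μ x i) +
        (1 / 2) * ∑ l, fderiv ℝ (fun y => Sig y i l) x (EuclideanSpace.single l 1) +
        (1 / 2) * ∑ j, Sig x i j *
          fderiv ℝ (fun y => Real.log (ρ y)) x (EuclideanSpace.single j 1))‖ ^ 2 ≤
      β * lammin / 2)
    (V : EuclideanSpace ℝ (Fin d) → ℝ) (hV : ContDiff ℝ (⊤ : ℕ∞) V)
    (hVsupp : HasCompactSupport V) :
    ∫ x, genOp μ Sig V x * V x * ρ x ≤
      (β / 2) * (∫ x, V x ^ 2 * ρ x) - (lammin / 4) * ∫ x, ‖gradient V x‖ ^ 2 * ρ x := by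
  let e : Fin d → EuclideanSpace ℝ (Fin d) := fun i => EuclideanSpace.single i 1
  obtain ⟨A, hAdef⟩ : ∃ A : Fin d → EuclideanSpace ℝ (Fin d) → ℝ, A = fun i x =>
      (1 / 2) * ((∑ j, Sig x i j * fderiv ℝ V x (e j)) * (V x * ρ x)) := ⟨_, rfl⟩
  have hVC2 : ContDiff ℝ 2 V := contDiff_infty.1 hV 2
  have hV1 : ContDiff ℝ 1 V := hVC2.of_le one_le_two
  have hdV : ∀ j, ContDiff ℝ 1 fun x => fderiv ℝ V x (e j) := fun j =>
    (hVC2.fderiv_right (m := 1) one_add_one_eq_two.le).clm_apply contDiff_const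
  have hA : ∀ i, ContDiff ℝ 1 (A i) := by
    intro i
    rw [hAdef]
    exact contDiff_const.mul
      ((ContDiff.sum fun j _ => (hSigC1 i j).mul (hdV j)).mul (hV1.mul hρC1))
  have hAs : ∀ i, HasCompactSupport (A i) := fun i =>
    hVsupp.mono fun x hx hx0 => hx (by simp [hAdef, hx0])
  have hdA : ∀ i, Integrable fun x => fderiv ℝ (A i) x (e i) := fun i =>
    (((hA i).continuous_fderiv one_ne_zero).clm_apply
      continuous_const).integrable_of_hasCompactSupport ((hAs i).fderiv_apply ℝ (e i))
  have hgrad : Continuous fun x => gradient V x :=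
    (InnerProductSpace.toDual ℝ (EuclideanSpace ℝ (Fin d))).symm.continuous.comp
      (hV1.continuous_fderiv one_ne_zero)
  have hgrads : HasCompactSupport fun x => gradient V x :=
    (hVsupp.fderiv ℝ).mono fun x hx hx0 => hx (by simp [gradient, hx0])
  have hV2 : Integrable fun x => V x ^ 2 * ρ x :=
    ((hV.continuous.pow 2).mul hρC1.continuous).integrable_of_hasCompactSupport
      (hVsupp.mono fun x hx hx0 => hx (by simp [hx0]))
  have hG2 : Integrable fun x => ‖gradient V x‖ ^ 2 * ρ x :=
    ((hgrad.norm.pow 2).mul hρC1.continuous).integrable_of_hasCompactSupport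
      (hgrads.mono fun x hx hx0 => hx (by simp [hx0]))
  have hHc : ∀ i j, Continuous fun x =>
      fderiv ℝ (fun y => fderiv ℝ V y (e j)) x (e i) := fun i j =>
    ((hdV j).continuous_fderiv one_ne_zero).clm_apply continuous_const
  have hLc : Continuous fun x => genOp μ Sig V x := by
    unfold genOp
    exact (hμ.inner hgrad).add (continuous_const.mul (continuous_finsetSum _ fun i _ =>
      continuous_finsetSum _ fun j _ => (hSigC1 i j).continuous.mul (hHc i j)))
  have hL : Integrable fun x => genOp μ Sig V x * V x * ρ x :=
    ((hLc.mul hV.continuous).mul hρC1.continuous).integrable_of_hasCompactSupport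
      hVsupp.mul_left.mul_right
  have hpt : ∀ x, genOp μ Sig V x * V x * ρ x ≤ (∑ i, fderiv ℝ (A i) x (e i)) +
      ((β / 2) * (V x ^ 2 * ρ x) - (lammin / 4) * (‖gradient V x‖ ^ 2 * ρ x)) := by
    rw [hAdef]
    exact genOp_mul_le_divergence_add hlammin hSigC1 hSigSymm hSigPos hρpos hρC1 hcond hVC2
  have hsum : Integrable fun x => ∑ i, fderiv ℝ (A i) x (e i) :=
    integrable_finsetSum _ fun i _ => hdA i
  have hdiff : Integrable fun x =>
      (β / 2) * (V x ^ 2 * ρ x) - (lammin / 4) * (‖gradient V x‖ ^ 2 * ρ x) :=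
    (hV2.const_mul _).sub (hG2.const_mul _)
  refine (integral_mono hL (hsum.add hdiff) hpt).trans_eq ?_
  simp only [Pi.add_apply]
  rw [integral_add hsum hdiff, integral_finsetSum _ fun i _ => hdA i,
    integral_sub (hV2.const_mul _) (hG2.const_mul _), integral_const_mul, integral_const_mul,
    Finset.sum_eq_zero fun i _ => integral_fderiv_apply_eq_zero volume (hA i) (hAs i) (e i),
    zero_add]
end

section
/- Let β > 0, Δt > 0, and R, λ̂, σ̂² ∈ ℝ. Set η = λ̂² Δt and assume β ≠ 2λ̂ + η. Define a₁ = R/(β − 2λ̂ − η) and a₀ = σ̂² a₁ / β, and let V̂(s) = a₁ s² + a₀. Then for every s ∈ ℝ, β V̂(s) = R s² + λ̂ s V̂'(s) + ((σ̂² + λ̂² s² Δt)/2) V̂''(s). -/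
/-- Closed-form quadratic solution of the first-order PhiBE for the scalar
linear-quadratic problem (equation `phibe-anlytic`). -/
theorem phibe_lq_closed_form (β Δt R lamhat sig2 : ℝ) (hβ : 0 < β) (hΔt : 0 < Δt)
    (hne : β ≠ 2 * lamhat + lamhat ^ 2 * Δt)
    (a1 a0 : ℝ)
    (ha1 : a1 = R / (β - 2 * lamhat - lamhat ^ 2 * Δt))
    (ha0 : a0 = sig2 * a1 / β)
    (Vhat : ℝ → ℝ) (hVhat : Vhat = fun s => a1 * s ^ 2 + a0) :
    ∀ s : ℝ,
      β * Vhat s =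
        R * s ^ 2 + lamhat * s * deriv Vhat s +
          ((sig2 + lamhat ^ 2 * s ^ 2 * Δt) / 2) * deriv (deriv Vhat) s := by
  intro s
  have hd : deriv Vhat = fun x => 2 * a1 * x := by
    funext x
    rw [hVhat]
    refine HasDerivAt.deriv ?_
    convert ((hasDerivAt_pow 2 x).const_mul a1).add_const a0 using 1
    push_cast
    ring
  have hdd : deriv (deriv Vhat) s = 2 * a1 := by
    rw [hd]
    simp
  have hden : β - 2 * lamhat - lamhat ^ 2 * Δt ≠ 0 := fun h => hne (by linarith)
  have h1 : a1 * (β - 2 * lamhat - lamhat ^ 2 * Δt) = R := by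
    rw [ha1, div_mul_cancel₀ _ hden]
  have h0 : a0 * β = sig2 * a1 := by
    rw [ha0, div_mul_cancel₀ _ hβ.ne']
  rw [hdd, hd, hVhat]
  linear_combination s ^ 2 * h1 + h0
end

section
/- Let β > 0, Δt > 0, λ ∈ ℝ, R ∈ ℝ, σ̂² > 0, and set γ = e^{−βΔt}; assume γ e^{2λΔt} < 1. Define a₁ = R Δt / (1 − γ e^{2λΔt}) and a₀ = γ Δt σ̂² a₁ / (1 − γ), and let Ṽ(s) = a₁ s² + a₀. Then for every s ∈ ℝ, Ṽ(s) = R s² Δt + γ ∫_ℝ Ṽ(s') dν_s(s'), where ν_s is the Gaussian measure on ℝ with mean e^{λΔt} s and variance σ̂² Δt. -/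
open MeasureTheory ProbabilityTheory Real

/-- The second moment of a real Gaussian measure. -/
theorem integral_sq_gaussianReal (m : ℝ) (v : NNReal) :
    ∫ x, x ^ 2 ∂(gaussianReal m v) = v + m ^ 2 := by
  have h := variance_eq_sub (memLp_id_gaussianReal (μ := m) (v := v) 2)
  rw [variance_id_gaussianReal] at h
  simp only [Pi.pow_apply, id_eq, integral_id_gaussianReal] at h
  linarith

theorem integrable_sq_gaussianReal (m : ℝ) (v : NNReal) :
    Integrable (fun x : ℝ => x ^ 2) (gaussianReal m v) :=
  (memLp_id_gaussianReal (μ := m) (v := v) 2).integrable_sq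

/-- Closed-form quadratic solution of the discrete-time Bellman equation for the
scalar linear-quadratic problem with Gaussian transitions (equation `be-anlytic`). -/
theorem bellman_lq_closed_form (β Δt lam R sig2 : ℝ) (hβ : 0 < β) (hΔt : 0 < Δt)
    (hsig2 : 0 < sig2)
    (γ : ℝ) (hγ : γ = Real.exp (-β * Δt))
    (hcontr : γ * Real.exp (2 * lam * Δt) < 1)
    (a1 a0 : ℝ)
    (ha1 : a1 = R * Δt / (1 - γ * Real.exp (2 * lam * Δt)))
    (ha0 : a0 = γ * Δt * sig2 * a1 / (1 - γ))
    (Vt : ℝ → ℝ) (hVt : Vt = fun s => a1 * s ^ 2 + a0) :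
    ∀ s : ℝ,
      Vt s = R * s ^ 2 * Δt +
        γ * ∫ s', Vt s' ∂(gaussianReal (Real.exp (lam * Δt) * s)
          (Real.toNNReal (sig2 * Δt))) := by
  intro s
  have hγ1 : γ < 1 := by
    rw [hγ, Real.exp_lt_one_iff]
    nlinarith [mul_pos hβ hΔt]
  have hexp : Real.exp (2 * lam * Δt) = Real.exp (lam * Δt) ^ 2 := by
    rw [← Real.exp_nat_mul]
    congr 1
    push_cast
    ring
  have hint : ∫ x, (a1 * x ^ 2 + a0) ∂(gaussianReal (Real.exp (lam * Δt) * s)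
      (Real.toNNReal (sig2 * Δt))) =
      a1 * (sig2 * Δt + (Real.exp (lam * Δt) * s) ^ 2) + a0 := by
    rw [integral_add ((integrable_sq_gaussianReal _ _).const_mul a1) (integrable_const a0),
      integral_const_mul, integral_sq_gaussianReal, Real.coe_toNNReal _ (by positivity)]
    simp
  have h1 : a1 * (1 - γ * Real.exp (lam * Δt) ^ 2) = R * Δt := by
    rw [ha1, hexp, div_mul_cancel₀]
    rw [← hexp]
    linarith
  have h0 : a0 * (1 - γ) = γ * Δt * sig2 * a1 := by
    rw [ha0, div_mul_cancel₀]
    linarith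
  simp only [hVt, hint]
  linear_combination s ^ 2 * h1 + h0
end
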